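/- arXiv:0706.2807 — 2 statements merged into one kernel-verified Lean document; each statement's English description precedes it below -/
import Mathlib

section
/- Let q ≥ 3 be an integer, let λ(q) be the exponent of the group (ℤ/qℤ)ˣ (Carmichael's lambda function), for b ∈ (ℤ/qℤ)ˣ let t_b be the multiplicative order of b, and let 𝒜(q) = { b ∈ (ℤ/qℤ)ˣ, b ≠ 1 : t_b < λ(q) }. Then the limit c(q, 1) = lim_{x → ∞} ∏_{p ≤ x, p ∤ q} (1 − 1/p)^{α(p; q, 1)} exists and equals ζ(λ(q))^{φ(q)/λ(q)} · Π(q, 1) · ∏_{p ∣ q} (1 − p^{−λ(q)})^{φ(q)/λ(q)} · ∏_{p ≡ 1 (mod q)} (1 − p^{−λ(q)})^{φ(q)/λ(q)} · ∏_{b ∈ 𝒜(q)} ∏_{p ≡ b (mod q)} { (1 − p^{−t_b})^{−φ(q)/t_b} · (1 − p^{−λ(q)})^{φ(q)/λ(q)} }, where ζ is the Riemann zeta function, all products over primes in residue classes are absolutely convergent, and Π(q, 1) = ∏_{χ mod q, χ ≠ χ₀} L(1, χ)^{−1}. -/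
open Filter Topology Finset

lemma norm_sum_range_smul_le_of_antitone {E : Type*} [NormedAddCommGroup E] [NormedSpace ℝ E]
    {f : ℕ → ℝ} {z : ℕ → E} {B : ℝ} (hf : Antitone f) (hf0 : ∀ i, 0 ≤ f i)
    (hz : ∀ n, ‖∑ i ∈ range n, z i‖ ≤ B) (n : ℕ) :
    ‖∑ i ∈ range n, f i • z i‖ ≤ B * f 0 := by
  have hB : 0 ≤ B := (norm_nonneg _).trans (hz 0)
  rcases n with _ | n
  · simpa using mul_nonneg hB (hf0 0)
  rw [Finset.sum_range_by_parts]
  calc _ ≤ ‖f n • ∑ i ∈ range (n + 1), z i‖ +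
        ‖∑ i ∈ range n, (f (i + 1) - f i) • ∑ j ∈ range (i + 1), z j‖ := norm_sub_le _ _
    _ ≤ f n * B + ∑ i ∈ range n, (f i - f (i + 1)) * B := by
        gcongr
        · rw [norm_smul, Real.norm_of_nonneg (hf0 n)]
          exact mul_le_mul_of_nonneg_left (hz _) (hf0 n)
        · refine norm_sum_le_of_le _ fun i _ ↦ ?_
          rw [norm_smul, Real.norm_of_nonpos (sub_nonpos.2 (hf (Nat.le_succ i))), neg_sub]
          exact mul_le_mul_of_nonneg_left (hz _) (sub_nonneg.2 (hf (Nat.le_succ i)))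
    _ = B * f 0 := by
        rw [← Finset.sum_mul, Finset.sum_range_sub']; ring

lemma norm_sum_Ico_smul_le_of_antitoneOn {E : Type*} [NormedAddCommGroup E] [NormedSpace ℝ E]
    {f : ℕ → ℝ} {z : ℕ → E} {B : ℝ} {m : ℕ} (hf : AntitoneOn f (Set.Ici m))
    (hf0 : ∀ i, m ≤ i → 0 ≤ f i) (hz : ∀ n, m ≤ n → ‖∑ i ∈ Ico m n, z i‖ ≤ B) (n : ℕ) :
    ‖∑ i ∈ Ico m n, f i • z i‖ ≤ B * f m := by
  rw [Finset.sum_Ico_eq_sum_range]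
  refine norm_sum_range_smul_le_of_antitone (f := fun i ↦ f (m + i)) (z := fun i ↦ z (m + i))
    (fun a b hab ↦ hf (by simp) (by simp) (by lia)) (fun i ↦ hf0 _ (by simp)) (fun k ↦ ?_) _
  simpa [Finset.sum_Ico_eq_sum_range] using hz (m + k) (by simp)

lemma norm_sum_Ico_le_of_norm_sum_range_le {E : Type*} [NormedAddCommGroup E] {z : ℕ → E} {B : ℝ}
    (hz : ∀ n, ‖∑ i ∈ range n, z i‖ ≤ B) {m n : ℕ} (hmn : m ≤ n) :
    ‖∑ i ∈ Ico m n, z i‖ ≤ 2 * B := by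
  rw [Finset.sum_Ico_eq_sub _ hmn]
  exact (norm_sub_le _ _).trans (by linarith [hz m, hz n])

/-- Dirichlet's test. -/
lemma exists_tendsto_sum_smul_of_antitoneOn {f : ℕ → ℝ} {z : ℕ → ℂ} {B : ℝ} {k : ℕ}
    (hf : AntitoneOn f (Set.Ici k)) (hf0 : Tendsto f atTop (𝓝 0))
    (hz : ∀ n, ‖∑ i ∈ range n, z i‖ ≤ B) :
    ∃ S, Tendsto (fun n ↦ ∑ i ∈ range n, f i • z i) atTop (𝓝 S) := by
  have hz' (n : ℕ) : ‖∑ i ∈ range n, z (i + k)‖ ≤ 2 * B := by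
    simpa [Finset.sum_Ico_eq_sum_range, add_comm] using
      norm_sum_Ico_le_of_norm_sum_range_le hz (Nat.le_add_right k n)
  have hc := Antitone.cauchySeq_series_mul_of_tendsto_zero_of_bounded
    (f := fun i ↦ f (i + k)) (z := fun i ↦ z (i + k))
    (fun a b hab ↦ hf (by simp) (by simp) (by lia)) ((tendsto_add_atTop_iff_nat k).2 hf0) hz'
  obtain ⟨S, hS⟩ := cauchySeq_tendsto_of_complete hc
  refine ⟨∑ i ∈ range k, f i • z i + S, (tendsto_add_atTop_iff_nat k).1 ?_⟩
  simpa [add_comm _ k, Finset.sum_range_add] using hS.const_add (∑ i ∈ range k, f i • z i)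

/-- Abel's limit theorem for monotone weights. -/
lemma tendsto_tsum_smul_of_antitoneOn {ι : Type*} {l : Filter ι} {v : ι → ℕ → ℝ} {a : ℕ → ℂ}
    {S : ℂ} (ha0 : a 0 = 0) (hv : ∀ᶠ s in l, AntitoneOn (v s) (Set.Ici 1))
    (hv0 : ∀ᶠ s in l, ∀ i, 0 ≤ v s i) (hv1 : ∀ i, 1 ≤ i → Tendsto (v · i) l (𝓝 1))
    (ha : Tendsto (fun n ↦ ∑ i ∈ range n, a i) atTop (𝓝 S))
    (hs : ∀ᶠ s in l, Summable fun i ↦ v s i • a i) :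
    Tendsto (fun s ↦ ∑' i, v s i • a i) l (𝓝 S) := by
  rw [Metric.tendsto_nhds]
  intro ε hε
  obtain ⟨N₀, hN₀⟩ := Metric.tendsto_atTop.1 ha (ε / 10) (by positivity)
  obtain ⟨N, hN1, hN⟩ : ∃ N, 1 ≤ N ∧ ∀ n ≥ N, dist (∑ i ∈ range n, a i) S < ε / 10 :=
    ⟨max N₀ 1, le_max_right _ _, fun n hn ↦ hN₀ n (le_trans (le_max_left _ _) hn)⟩
  have hinit : Tendsto (fun s ↦ ∑ i ∈ range N, v s i • a i) l (𝓝 (∑ i ∈ range N, a i)) := by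
    refine tendsto_finsetSum _ fun i _ ↦ ?_
    rcases Nat.eq_zero_or_pos i with rfl | hi
    · simp [ha0, tendsto_const_nhds]
    · simpa using (hv1 i hi).smul_const (a i)
  filter_upwards [hv, hv0, hs, Metric.tendsto_nhds.1 hinit (ε / 10) (by positivity),
    (hv1 N hN1).eventually (gt_mem_nhds one_lt_two)] with s hv hv0 hs hinit hvN
  have htail : dist (∑' i, v s i • a i) (∑ i ∈ range N, v s i • a i) ≤ ε / 5 * 2 := by
    have ht : Tendsto (fun n ↦ ∑ i ∈ range n, v s i • a i) atTop (𝓝 (∑' i, v s i • a i)) :=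
      hs.hasSum.tendsto_sum_nat
    refine le_of_tendsto (ht.dist tendsto_const_nhds) ?_
    filter_upwards [eventually_ge_atTop N] with n hn
    rw [dist_eq_norm, ← Finset.sum_Ico_eq_sub _ hn]
    calc _ ≤ ε / 5 * v s N := by
          refine norm_sum_Ico_smul_le_of_antitoneOn (hv.mono (Set.Ici_subset_Ici.2 hN1))
            (fun i _ ↦ hv0 i) (fun k hk ↦ ?_) n
          rw [Finset.sum_Ico_eq_sub _ hk, ← dist_eq_norm]
          linarith [dist_triangle_right (∑ i ∈ range k, a i) (∑ i ∈ range N, a i) S,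
            hN k hk, hN N le_rfl]
      _ ≤ _ := by gcongr
  have h1 := dist_triangle (∑' i, v s i • a i) (∑ i ∈ range N, v s i • a i) (∑ i ∈ range N, a i)
  have h2 := dist_triangle (∑' i, v s i • a i) (∑ i ∈ range N, a i) S
  linarith [hN N le_rfl]

/-- Abel's limit theorem for Dirichlet series at `s = 1`. -/
lemma LSeries_tendsto_nhdsGT_one {b : ℕ → ℂ} {S : ℂ} (hb0 : b 0 = 0)
    (hb : Tendsto (fun n ↦ ∑ i ∈ range n, (i : ℝ)⁻¹ • b i) atTop (𝓝 S))
    (hs : ∀ s : ℝ, 1 < s → LSeriesSummable b s) :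
    Tendsto (fun s : ℝ ↦ LSeries b s) (𝓝[>] 1) (𝓝 S) := by
  have hterm (s : ℝ) (i : ℕ) :
      (i : ℝ) ^ (1 - s) • (i : ℝ)⁻¹ • b i = LSeries.term b s i := by
    rcases Nat.eq_zero_or_pos i with rfl | hi
    · simp [hb0]
    · have hi' : (0 : ℝ) < i := by exact_mod_cast hi
      rw [LSeries.term_of_ne_zero hi.ne', smul_smul, ← Real.rpow_neg_one, ← Real.rpow_add hi',
        show 1 - s + -1 = -s by ring, Real.rpow_neg hi'.le, Complex.real_smul]
      push_cast [Complex.ofReal_cpow hi'.le]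
      ring
  have key := tendsto_tsum_smul_of_antitoneOn (l := 𝓝[>] (1 : ℝ))
    (v := fun s i ↦ (i : ℝ) ^ (1 - s)) (a := fun i ↦ (i : ℝ)⁻¹ • b i) (by simp) ?_ ?_ ?_ hb ?_
  · simpa only [LSeries, hterm] using key
  · filter_upwards [self_mem_nhdsWithin] with s (hs : 1 < s) i hi j hj hij
    have hi' : (0 : ℝ) < i := by exact_mod_cast (hi : 1 ≤ i)
    exact Real.rpow_le_rpow_of_nonpos hi' (by exact_mod_cast hij) (by linarith)
  · exact Eventually.of_forall fun s i ↦ by positivity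
  · intro i hi
    have hi' : (i : ℝ) ≠ 0 := by exact_mod_cast (by lia : i ≠ 0)
    have : ContinuousAt (fun s : ℝ ↦ (i : ℝ) ^ (1 - s)) 1 :=
      (Real.continuousAt_const_rpow hi').comp (by fun_prop)
    simpa using this.tendsto.mono_left nhdsWithin_le_nhds
  · filter_upwards [self_mem_nhdsWithin] with s (hs' : 1 < s)
    simp only [hterm]
    exact hs s hs'

lemma natCast_inv_antitoneOn : AntitoneOn (fun i : ℕ ↦ (i : ℝ)⁻¹) (Set.Ici 1) := by
  intro i hi j hj hij
  have hi' : (0 : ℝ) < i := by exact_mod_cast (hi : 1 ≤ i)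
  exact inv_anti₀ hi' (by exact_mod_cast hij)

namespace DirichletCharacter

variable {q : ℕ} [NeZero q] {χ : DirichletCharacter ℂ q}

lemma apply_zero_of_ne_one (hχ : χ ≠ 1) : χ 0 = 0 := by
  have : Fact (1 < q) := ⟨by
    by_contra h
    obtain rfl : q = 1 := by have := NeZero.pos q; lia
    exact hχ (level_one χ)⟩
  exact χ.map_zero

lemma sum_range_level_eq_zero (hχ : χ ≠ 1) : ∑ i ∈ range q, χ (i : ZMod q) = 0 := by
  rw [← MulChar.sum_eq_zero_of_ne_one hχ]
  refine Finset.sum_nbij' (fun i ↦ (i : ZMod q)) ZMod.val (by simp)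
    (fun a _ ↦ by simpa using ZMod.val_lt a) (fun i hi ↦ ZMod.val_cast_of_lt (by simpa using hi))
    (fun a _ ↦ by simp) (by simp)

lemma norm_sum_range_le (hχ : χ ≠ 1) (n : ℕ) : ‖∑ i ∈ range n, χ (i : ZMod q)‖ ≤ q := by
  induction n using Nat.strong_induction_on with
  | _ n ih =>
    by_cases hn : n < q
    · calc _ ≤ ∑ i ∈ range n, (1 : ℝ) := norm_sum_le_of_le _ fun i _ ↦ χ.norm_le_one _
        _ ≤ q := by simpa using hn.le
    · obtain ⟨m, rfl⟩ := Nat.exists_eq_add_of_le (not_lt.1 hn)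
      rw [Finset.sum_range_add, sum_range_level_eq_zero hχ, zero_add]
      simpa using ih m (by have := NeZero.pos q; lia)

lemma tendsto_LSeries_nhdsGT_one (hχ : χ ≠ 1) :
    Tendsto (fun s : ℝ ↦ LSeries (fun n ↦ χ (n : ZMod q)) s) (𝓝[>] 1) (𝓝 (LFunction χ 1)) := by
  have hc : ContinuousAt (fun s : ℝ ↦ LFunction χ s) 1 :=
    ((differentiable_LFunction hχ).continuous.comp Complex.continuous_ofReal).continuousAt
  have := hc.tendsto.mono_left (nhdsWithin_le_nhds (s := Set.Ioi 1))
  rw [Complex.ofReal_one] at this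
  refine this.congr' ?_
  filter_upwards [self_mem_nhdsWithin] with s (hs : 1 < s)
  exact LFunction_eq_LSeries χ (by simpa using hs)

lemma tendsto_sum_inv_smul (hχ : χ ≠ 1) :
    Tendsto (fun n ↦ ∑ i ∈ range n, (i : ℝ)⁻¹ • χ (i : ZMod q)) atTop (𝓝 (LFunction χ 1)) := by
  obtain ⟨S, hS⟩ := exists_tendsto_sum_smul_of_antitoneOn natCast_inv_antitoneOn
    tendsto_inv_atTop_nhds_zero_nat (norm_sum_range_le hχ)
  have h := LSeries_tendsto_nhdsGT_one (b := fun n ↦ χ (n : ZMod q))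
    (by simpa using apply_zero_of_ne_one hχ) hS
    fun s hs ↦ χ.LSeriesSummable_of_one_lt_re (by simpa using hs)
  rwa [tendsto_nhds_unique (tendsto_LSeries_nhdsGT_one hχ) h]

lemma norm_LFunction_one_sub_sum_le (hχ : χ ≠ 1) {N : ℕ} (hN : 1 ≤ N) :
    ‖LFunction χ 1 - ∑ i ∈ range N, (i : ℝ)⁻¹ • χ (i : ZMod q)‖ ≤ 2 * q * (N : ℝ)⁻¹ := by
  refine le_of_tendsto ((tendsto_sum_inv_smul hχ).sub_const _).norm ?_
  filter_upwards [eventually_ge_atTop N] with n hn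
  rw [← Finset.sum_Ico_eq_sub _ hn]
  exact norm_sum_Ico_smul_le_of_antitoneOn
    (natCast_inv_antitoneOn.mono (Set.Ici_subset_Ici.2 hN)) (fun i _ ↦ by positivity)
    (fun k hk ↦ norm_sum_Ico_le_of_norm_sum_range_le (norm_sum_range_le hχ) hk) n

end DirichletCharacter

lemma sum_Ioc_zero_eq_sum_range {M : Type*} [AddCommMonoid M] {h : ℕ → M} (h0 : h 0 = 0) (N : ℕ) :
    ∑ n ∈ Ioc 0 N, h n = ∑ n ∈ range (N + 1), h n := by
  rw [Finset.sum_range_succ', h0, add_zero, Finset.range_eq_Ico, Finset.sum_Ico_add' h 0 N 1]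
  rfl

lemma exists_norm_le_of_tendsto {u : ℕ → ℂ} {S : ℂ} (hu : Tendsto u atTop (𝓝 S)) :
    ∃ B, ∀ n, ‖u n‖ ≤ B := by
  obtain ⟨B, hB⟩ := (Metric.isBounded_range_of_tendsto u hu).exists_norm_le
  exact ⟨B, fun n ↦ hB _ ⟨n, rfl⟩⟩

namespace DirichletCharacter

open ArithmeticFunction (vonMangoldt)

variable {q : ℕ} {χ : DirichletCharacter ℂ q}

lemma sum_log_eq (χ : DirichletCharacter ℂ q) (N : ℕ) :
    ∑ n ∈ range (N + 1), (Real.log n / n) • χ (n : ZMod q) =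
      ∑ d ∈ range (N + 1), ((vonMangoldt d / d) • χ (d : ZMod q)) *
        ∑ m ∈ range (N / d + 1), (m : ℝ)⁻¹ • χ (m : ZMod q) := by
  let f : ArithmeticFunction ℂ := ⟨fun d ↦ (vonMangoldt d / d) • χ (d : ZMod q), by simp⟩
  let g : ArithmeticFunction ℂ := ⟨fun m ↦ (m : ℝ)⁻¹ • χ (m : ZMod q), by simp⟩
  have h := ArithmeticFunction.sum_Ioc_mul_eq_sum_sum f g N
  rw [sum_Ioc_zero_eq_sum_range (by simp), sum_Ioc_zero_eq_sum_range (by simp)] at h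
  convert h using 2 with n hn d hd
  · rw [ArithmeticFunction.mul_apply, ← ArithmeticFunction.vonMangoldt_sum,
      ← Nat.sum_divisorsAntidiagonal (fun d _ ↦ vonMangoldt d), Finset.sum_div, Finset.sum_smul]
    refine Finset.sum_congr rfl fun x hx ↦ ?_
    obtain ⟨rfl, -⟩ := Nat.mem_divisorsAntidiagonal.1 hx
    simp only [f, g, ArithmeticFunction.coe_mk, Complex.real_smul, Nat.cast_mul, map_mul]
    push_cast
    ring
  · rw [sum_Ioc_zero_eq_sum_range (by simp)]
    rfl

variable [NeZero q]

lemma exists_norm_sum_log_le (hχ : χ ≠ 1) :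
    ∃ B, ∀ n, ‖∑ i ∈ range n, (Real.log i / i) • χ (i : ZMod q)‖ ≤ B := by
  have h3 (i : ℕ) (hi : 3 ≤ i) : Real.exp 1 ≤ i := by
    have : (3 : ℝ) ≤ i := by exact_mod_cast hi
    linarith [Real.exp_one_lt_three]
  have hanti : AntitoneOn (fun i : ℕ ↦ Real.log i / i) (Set.Ici 3) := fun i hi j hj hij ↦
    Real.log_div_self_antitoneOn (h3 i hi) (h3 j hj) (by exact_mod_cast hij)
  have hlim : Tendsto (fun i : ℕ ↦ Real.log i / i) atTop (𝓝 0) :=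
    Real.isLittleO_log_id_atTop.tendsto_div_nhds_zero.comp tendsto_natCast_atTop_atTop
  obtain ⟨S, hS⟩ := exists_tendsto_sum_smul_of_antitoneOn hanti hlim (norm_sum_range_le hχ)
  exact exists_norm_le_of_tendsto hS

lemma exists_norm_sum_vonMangoldt_le (hχ : χ ≠ 1) :
    ∃ B, ∀ n, ‖∑ i ∈ range n, (vonMangoldt i / i) • χ (i : ZMod q)‖ ≤ B := by
  obtain ⟨B, hB⟩ := exists_norm_sum_log_le hχ
  have hL := LFunction_apply_one_ne_zero hχ
  have hL' : 0 < ‖LFunction χ 1‖ := norm_pos_iff.2 hL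
  have hB0 : 0 ≤ B := (norm_nonneg _).trans (hB 0)
  have h4 : 0 ≤ Real.log 4 + 4 := by positivity
  refine ⟨(B + 2 * q * (Real.log 4 + 4)) / ‖LFunction χ 1‖, fun n ↦ ?_⟩
  rcases n with _ | N
  · simpa using by positivity
  rw [le_div_iff₀ hL', ← norm_mul, Finset.sum_mul]
  set P : ℕ → ℂ := fun n ↦ ∑ m ∈ range n, (m : ℝ)⁻¹ • χ (m : ZMod q)
  have hsplit : ∑ i ∈ range (N + 1), (vonMangoldt i / i) • χ (i : ZMod q) * LFunction χ 1 =
      ∑ n ∈ range (N + 1), (Real.log n / n) • χ (n : ZMod q) +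
      ∑ i ∈ range (N + 1), (vonMangoldt i / i) • χ (i : ZMod q) *
        (LFunction χ 1 - P (N / i + 1)) := by
    rw [sum_log_eq, ← Finset.sum_add_distrib]
    exact Finset.sum_congr rfl fun i _ ↦ by ring
  rw [hsplit]
  refine (norm_add_le _ _).trans (add_le_add (hB _) ?_)
  rcases Nat.eq_zero_or_pos N with rfl | hN
  · simpa using by positivity
  have hN' : (0 : ℝ) < N := by exact_mod_cast hN
  calc _ ≤ ∑ i ∈ range (N + 1), 2 * q * (N : ℝ)⁻¹ * vonMangoldt i := by
        refine norm_sum_le_of_le _ fun i _ ↦ ?_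
        rcases Nat.eq_zero_or_pos i with rfl | hi
        · simp
        have hi' : (0 : ℝ) < i := by exact_mod_cast hi
        have hfl : (N / i : ℝ) ≤ (N / i + 1 : ℕ) := by
          rw [div_le_iff₀ hi']
          exact_mod_cast (by nlinarith [Nat.lt_div_mul_add hi (a := N)] : N ≤ (N / i + 1) * i)
        rw [norm_mul, norm_smul, Real.norm_of_nonneg
          (div_nonneg ArithmeticFunction.vonMangoldt_nonneg hi'.le)]
        calc _ ≤ vonMangoldt i / i * 1 * (2 * q * ((N / i + 1 : ℕ) : ℝ)⁻¹) := by
              have := ArithmeticFunction.vonMangoldt_nonneg (n := i)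
              gcongr
              · exact χ.norm_le_one _
              · exact norm_LFunction_one_sub_sum_le hχ (by lia)
          _ ≤ vonMangoldt i / i * 1 * (2 * q * (N / i : ℝ)⁻¹) := by
              have := ArithmeticFunction.vonMangoldt_nonneg (n := i)
              gcongr
          _ = _ := by field_simp
    _ = 2 * q * (N : ℝ)⁻¹ * Chebyshev.psi N := by
        rw [← Finset.mul_sum, Chebyshev.psi_eq_sum_Icc, Nat.floor_natCast, Nat.range_succ_eq_Icc_zero]
    _ ≤ 2 * q * (N : ℝ)⁻¹ * ((Real.log 4 + 4) * N) := by
        gcongr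
        exact Chebyshev.psi_le_const_mul_self hN'.le
    _ = _ := by field_simp

lemma exists_norm_sum_primes_log_le (hχ : χ ≠ 1) :
    ∃ B, ∀ n, ‖∑ i ∈ range n,
      if i.Prime then (Real.log i / i) • χ (i : ZMod q) else 0‖ ≤ B := by
  obtain ⟨B, hB⟩ := exists_norm_sum_vonMangoldt_le hχ
  have hsum := ArithmeticFunction.vonMangoldt.summable_residueClass_non_primes_div (0 : ZMod 1)
  set F : ℕ → ℝ := fun n ↦ (if n.Prime then 0 else
    ArithmeticFunction.vonMangoldt.residueClass (0 : ZMod 1) n) / n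
  have hF (n : ℕ) : F n = if n.Prime then 0 else vonMangoldt n / n := by
    have : ArithmeticFunction.vonMangoldt.residueClass (0 : ZMod 1) n = vonMangoldt n :=
      Set.indicator_of_mem (s := {n : ℕ | (n : ZMod 1) = 0}) (Subsingleton.elim _ _) _
    simp only [F, this]
    split_ifs <;> simp
  have hF0 (n : ℕ) : 0 ≤ F n := by
    rw [hF]
    split_ifs
    · rfl
    · exact div_nonneg ArithmeticFunction.vonMangoldt_nonneg n.cast_nonneg
  refine ⟨B + ∑' n, F n, fun n ↦ ?_⟩
  have hsplit : ∑ i ∈ range n, (if i.Prime then (Real.log i / i) • χ (i : ZMod q) else 0) =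
      ∑ i ∈ range n, (vonMangoldt i / i) • χ (i : ZMod q) -
      ∑ i ∈ range n, F i • χ (i : ZMod q) := by
    rw [← Finset.sum_sub_distrib]
    refine Finset.sum_congr rfl fun i _ ↦ ?_
    rw [hF]
    split_ifs with hi
    · rw [ArithmeticFunction.vonMangoldt_apply_prime hi, zero_smul, sub_zero]
    · rw [sub_self]
  rw [hsplit]
  refine (norm_sub_le _ _).trans (add_le_add (hB n) ?_)
  refine le_trans (norm_sum_le_of_le _ fun i _ ↦ ?_) (hsum.sum_le_tsum (range n) fun i _ ↦ hF0 i)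
  rw [norm_smul, Real.norm_of_nonneg (hF0 i)]
  exact mul_le_of_le_one_right (hF0 i) (χ.norm_le_one _)

lemma exists_tendsto_sum_primes_inv_smul (hχ : χ ≠ 1) :
    ∃ S, Tendsto (fun n ↦ ∑ i ∈ range n, (i : ℝ)⁻¹ • if i.Prime then χ (i : ZMod q) else 0)
      atTop (𝓝 S) := by
  obtain ⟨B, hB⟩ := exists_norm_sum_primes_log_le hχ
  have hanti : AntitoneOn (fun i : ℕ ↦ (Real.log i)⁻¹) (Set.Ici 2) := by
    intro i hi j hj hij
    have hi' : (1 : ℝ) < i := by exact_mod_cast (hi : 2 ≤ i)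
    exact inv_anti₀ (Real.log_pos hi') (Real.log_le_log (by linarith) (by exact_mod_cast hij))
  have hlim : Tendsto (fun i : ℕ ↦ (Real.log i)⁻¹) atTop (𝓝 0) :=
    (Real.tendsto_log_atTop.comp tendsto_natCast_atTop_atTop).inv_tendsto_atTop
  obtain ⟨S, hS⟩ := exists_tendsto_sum_smul_of_antitoneOn hanti hlim hB
  refine ⟨S, hS.congr fun n ↦ Finset.sum_congr rfl fun i _ ↦ ?_⟩
  split_ifs with hi
  · have : Real.log i ≠ 0 := (Real.log_pos (by exact_mod_cast hi.one_lt)).ne'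
    rw [smul_smul]
    congr 1
    field_simp
  · simp

end DirichletCharacter

lemma Complex.norm_neg_log_one_sub_sub_self_le {z : ℂ} (hz : ‖z‖ ≤ 1 / 2) :
    ‖-log (1 - z) - z‖ ≤ ‖z‖ ^ 2 := by
  have h := norm_log_one_add_sub_self_le (z := -z) (by rw [norm_neg]; linarith)
  rw [norm_neg, ← sub_eq_add_neg] at h
  rw [show -log (1 - z) - z = -(log (1 - z) - -z) by ring, norm_neg]
  have h2 : (1 - ‖z‖)⁻¹ ≤ 2 := by
    rw [inv_le_comm₀ (by linarith) two_pos]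
    linarith
  nlinarith [sq_nonneg ‖z‖]

lemma tendsto_sum_primesBelow {f : ℕ → ℂ} {S : ℂ} (h : HasSum (fun p : Nat.Primes ↦ f p) S) :
    Tendsto (fun n : ℕ ↦ ∑ p ∈ n.primesBelow, f p) atTop (𝓝 S) := by
  refine ((Nat.Primes.hasSum_iff_hasSum_ite f).1 h).tendsto_sum_nat.congr fun n ↦ ?_
  rw [Nat.primesBelow, Finset.sum_filter]

namespace DirichletCharacter

variable {q : ℕ} {χ : DirichletCharacter ℂ q}

/-- The Euler factor of `χ` at `p` has its logarithm equal to `χ(p) p⁻ˢ` up to this error. -/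
noncomputable def logEulerFactorError (χ : DirichletCharacter ℂ q) (s : ℝ) (p : ℕ) : ℂ :=
  -Complex.log (1 - χ (p : ZMod q) * (p : ℂ) ^ (-(s : ℂ))) - χ (p : ZMod q) * (p : ℂ) ^ (-(s : ℂ))

lemma norm_apply_mul_cpow_le (χ : DirichletCharacter ℂ q) {s : ℝ} (hs : 1 ≤ s) {p : ℕ}
    (hp : p.Prime) : ‖χ (p : ZMod q) * (p : ℂ) ^ (-(s : ℂ))‖ ≤ (p : ℝ)⁻¹ := by
  have hp1 : (1 : ℝ) ≤ p := by exact_mod_cast hp.one_le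
  rw [norm_mul, Complex.norm_natCast_cpow_of_pos hp.pos, Complex.neg_re, Complex.ofReal_re]
  calc _ ≤ 1 * (p : ℝ) ^ (-1 : ℝ) := by
        gcongr
        exact χ.norm_le_one _
    _ = _ := by rw [one_mul, Real.rpow_neg_one]

lemma inv_natCast_le_half {p : ℕ} (hp : p.Prime) : (p : ℝ)⁻¹ ≤ 1 / 2 := by
  rw [one_div]
  exact inv_anti₀ two_pos (by exact_mod_cast hp.two_le)

lemma norm_logEulerFactorError_le (χ : DirichletCharacter ℂ q) {s : ℝ} (hs : 1 ≤ s) {p : ℕ}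
    (hp : p.Prime) : ‖logEulerFactorError χ s p‖ ≤ (p : ℝ) ^ (-2 : ℝ) := by
  have h := norm_apply_mul_cpow_le χ hs hp
  refine (Complex.norm_neg_log_one_sub_sub_self_le (h.trans (inv_natCast_le_half hp))).trans ?_
  calc _ ≤ ((p : ℝ)⁻¹) ^ 2 := by gcongr
    _ = _ := by rw [Real.rpow_neg (by positivity), Real.rpow_ofNat, inv_pow]

lemma summable_logEulerFactorError (χ : DirichletCharacter ℂ q) {s : ℝ} (hs : 1 ≤ s) :
    Summable fun p : Nat.Primes ↦ logEulerFactorError χ s p :=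
  .of_norm_bounded (Nat.Primes.summable_rpow.2 (by norm_num))
    fun p ↦ norm_logEulerFactorError_le χ hs p.2

lemma tendsto_tsum_logEulerFactorError (χ : DirichletCharacter ℂ q) :
    Tendsto (fun s ↦ ∑' p : Nat.Primes, logEulerFactorError χ s p) (𝓝[>] 1)
      (𝓝 (∑' p : Nat.Primes, logEulerFactorError χ 1 p)) := by
  refine tendsto_tsum_of_dominated_convergence
    (bound := fun p : Nat.Primes ↦ (p : ℝ) ^ (-2 : ℝ))
    (Nat.Primes.summable_rpow.2 (by norm_num)) (fun p ↦ ?_) ?_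
  · have hp0 : ((p : ℕ) : ℂ) ≠ 0 := by exact_mod_cast p.2.ne_zero
    have hz := (norm_apply_mul_cpow_le χ le_rfl p.2).trans (inv_natCast_le_half p.2)
    have hmem : 1 - χ ((p : ℕ) : ZMod q) * ((p : ℕ) : ℂ) ^ (-((1 : ℝ) : ℂ)) ∈
        Complex.slitPlane := by
      rw [sub_eq_add_neg]
      exact Complex.mem_slitPlane_of_norm_lt_one (by rw [norm_neg]; linarith)
    have hc : ContinuousAt
        (fun s : ℝ ↦ χ ((p : ℕ) : ZMod q) * ((p : ℕ) : ℂ) ^ (-(s : ℂ))) 1 := by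
      refine continuousAt_const.mul (ContinuousAt.const_cpow (by fun_prop) (Or.inl hp0))
    have : ContinuousAt (fun s ↦ logEulerFactorError χ s p) 1 :=
      (((continuousAt_const.sub hc).clog hmem).neg).sub hc
    exact this.tendsto.mono_left nhdsWithin_le_nhds
  · filter_upwards [self_mem_nhdsWithin] with s hs p
    exact norm_logEulerFactorError_le χ (le_of_lt hs) p.2

variable [NeZero q]

/-- The Euler product of `L(s, χ)`, `χ ≠ 1`, converges conditionally at `s = 1`. -/
theorem tendsto_prod_primesBelow_eulerFactor_one (hχ : χ ≠ 1) :
    Tendsto (fun n : ℕ ↦ ∏ p ∈ n.primesBelow, (1 - χ (p : ZMod q) * (p : ℂ)⁻¹)) atTop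
      (𝓝 (LFunction χ 1)⁻¹) := by
  obtain ⟨S, hS⟩ := exists_tendsto_sum_primes_inv_smul hχ
  set b : ℕ → ℂ := fun i ↦ if i.Prime then χ (i : ZMod q) else 0
  have hbs (s : ℝ) (hs : 1 < s) : LSeriesSummable b s := by
    refine LSeriesSummable_of_bounded_of_one_lt_re (m := 1) (fun n _ ↦ ?_) (by simpa using hs)
    simp only [b]
    split_ifs
    · exact χ.norm_le_one _
    · simp
  have hterm (s : ℝ) : LSeries.term b s = Set.indicator {p : ℕ | p.Prime}
      (fun p ↦ χ (p : ZMod q) * (p : ℂ) ^ (-(s : ℂ))) := by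
    ext n
    by_cases hn : n.Prime
    · rw [LSeries.term_of_ne_zero hn.ne_zero, Set.indicator_of_mem (by exact hn)]
      simp [b, hn, Complex.cpow_neg, div_eq_mul_inv]
    · rw [Set.indicator_of_notMem (by exact hn)]
      simp [LSeries.term, b, hn]
  have hlim := LSeries_tendsto_nhdsGT_one (by simp [Nat.not_prime_zero]) hS hbs
  have hexp : LFunction χ 1 =
      Complex.exp (∑' p : Nat.Primes, logEulerFactorError χ 1 p + S) := by
    refine tendsto_nhds_unique (tendsto_LSeries_nhdsGT_one hχ) ?_
    refine ((tendsto_tsum_logEulerFactorError χ).add hlim).cexp.congr' ?_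
    filter_upwards [self_mem_nhdsWithin] with s (hs : 1 < s)
    have hsum : Summable fun p : Nat.Primes ↦ χ ((p : ℕ) : ZMod q) * ((p : ℕ) : ℂ) ^ (-(s : ℂ)) := by
      have := hbs s hs
      rw [LSeriesSummable, hterm] at this
      exact summable_subtype_iff_indicator.2 this
    have htsum : LSeries b s =
        ∑' p : Nat.Primes, χ ((p : ℕ) : ZMod q) * ((p : ℕ) : ℂ) ^ (-(s : ℂ)) := by
      rw [LSeries, hterm]
      exact (tsum_subtype {p : ℕ | p.Prime} _).symm
    rw [← LSeries_eulerProduct_exp_log χ (s := s) (by simpa using hs), htsum,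
      ← (summable_logEulerFactorError χ hs.le).tsum_add hsum]
    congr 1
    exact tsum_congr fun p ↦ sub_add_cancel _ _
  have herr : Tendsto (fun n : ℕ ↦ ∑ p ∈ n.primesBelow, logEulerFactorError χ 1 p) atTop
      (𝓝 (∑' p : Nat.Primes, logEulerFactorError χ 1 p)) :=
    tendsto_sum_primesBelow (summable_logEulerFactorError χ le_rfl).hasSum
  rw [hexp, ← Complex.exp_neg]
  refine (herr.add hS).neg.cexp.congr fun n ↦ ?_
  have hS' : ∑ i ∈ range n, (i : ℝ)⁻¹ • b i =
      ∑ p ∈ n.primesBelow, χ (p : ZMod q) * (p : ℂ)⁻¹ := by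
    rw [Nat.primesBelow, Finset.sum_filter]
    refine Finset.sum_congr rfl fun i _ ↦ ?_
    simp only [b]
    split_ifs <;> simp [mul_comm]
  rw [hS', ← Finset.sum_add_distrib, ← Finset.sum_neg_distrib, Complex.exp_sum]
  refine Finset.prod_congr rfl fun p hp ↦ ?_
  have hp := Nat.prime_of_mem_primesBelow hp
  have hz := (norm_apply_mul_cpow_le χ le_rfl hp).trans (inv_natCast_le_half hp)
  simp only [logEulerFactorError, Complex.ofReal_one, Complex.cpow_neg_one] at hz ⊢
  rw [sub_add_cancel, neg_neg, Complex.exp_log]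
  intro h0
  rw [← sub_eq_zero.1 h0] at hz
  norm_num at hz

end DirichletCharacter

namespace DirichletCharacter

variable {q : ℕ} [NeZero q]

open scoped Classical in
lemma image_apply_eq_nthRootsFinset (b : (ZMod q)ˣ) :
    univ.image (fun χ : DirichletCharacter ℂ q ↦ χ (b : ZMod q)) =
      Polynomial.nthRootsFinset (orderOf b) (1 : ℂ) := by
  have ht : 0 < orderOf b := orderOf_pos b
  let ev : DirichletCharacter ℂ q →* ℂˣ :=
    { toFun χ := χ.toUnitHom b
      map_one' := by ext; simp
      map_mul' χ ψ := by ext; simp }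
  have hev (χ : DirichletCharacter ℂ q) : ((ev χ : ℂˣ) : ℂ) = χ (b : ZMod q) :=
    MulChar.coe_toUnitHom χ b
  refine Finset.eq_of_subset_of_card_le (fun z hz ↦ ?_) ?_
  · obtain ⟨χ, -, rfl⟩ := Finset.mem_image.1 hz
    rw [Polynomial.mem_nthRootsFinset ht, ← map_pow, ← Units.val_pow_eq_pow_val, pow_orderOf_eq_one,
      Units.val_one, map_one]
  · rw [(Complex.isPrimitiveRoot_exp _ ht.ne').card_nthRootsFinset]
    have hcard : (univ.image fun χ : DirichletCharacter ℂ q ↦ χ (b : ZMod q)).card =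
        Nat.card ev.range := by
      have h1 : (univ.image fun χ : DirichletCharacter ℂ q ↦ χ (b : ZMod q)) =
          (univ.image ev).image Units.val := by
        rw [Finset.image_image]
        exact Finset.image_congr fun χ _ ↦ (hev χ).symm
      rw [h1, Finset.card_image_of_injective _ Units.val_injective, ← Nat.card_eq_finsetCard]
      exact Nat.card_congr (Equiv.subtypeEquivRight fun z ↦ by simp)
    rw [hcard]
    refine Nat.le_of_dvd Nat.card_pos (orderOf_dvd_of_pow_eq_one ?_)
    by_contra hne
    obtain ⟨χ, hχ⟩ := exists_apply_ne_one_of_hasEnoughRootsOfUnity ℂ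
      (a := ((b ^ Nat.card ev.range : (ZMod q)ˣ) : ZMod q)) (by rwa [Ne, Units.val_eq_one])
    refine hχ ?_
    have := pow_card_eq_one' (x := (⟨ev χ, χ, rfl⟩ : ev.range))
    have := congrArg (fun x : ev.range ↦ ((x : ℂˣ) : ℂ)) this
    simpa [hev] using this

open scoped Classical in
/-- The product over all Dirichlet characters of the Euler factors at an invertible residue. -/
lemma prod_one_sub_apply_mul (b : (ZMod q)ˣ) (X : ℂ) :
    ∏ χ : DirichletCharacter ℂ q, (1 - χ (b : ZMod q) * X) =
      (1 - X ^ orderOf b) ^ (q.totient / orderOf b) := by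
  have ht : 0 < orderOf b := orderOf_pos b
  let ev : DirichletCharacter ℂ q →* ℂ :=
    { toFun χ := χ (b : ZMod q)
      map_one' := by simp
      map_mul' χ ψ := by simp }
  have himage : univ.image ev = Polynomial.nthRootsFinset (orderOf b) (1 : ℂ) :=
    image_apply_eq_nthRootsFinset b
  set k := #{χ | ev χ = 1}
  have hfib (z : ℂ) (hz : z ∈ univ.image ev) : #{χ | ev χ = z} = k := by
    obtain ⟨χ, -, rfl⟩ := Finset.mem_image.1 hz
    exact MonoidHom.card_fiber_eq_of_mem_range ev ⟨χ, rfl⟩ ⟨1, map_one ev⟩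
  have hroot := Complex.isPrimitiveRoot_exp _ ht.ne'
  have hk : q.totient = orderOf b * k := by
    rw [← card_eq_totient_of_hasEnoughRootsOfUnity ℂ q, Nat.card_eq_fintype_card,
      ← Finset.card_univ, Finset.card_eq_sum_card_image ev, Finset.sum_congr rfl hfib,
      Finset.sum_const, himage, hroot.card_nthRootsFinset, smul_eq_mul]
  calc _ = ∏ χ : DirichletCharacter ℂ q, (1 - ev χ * X) := rfl
    _ = ∏ z ∈ univ.image ev, (1 - z * X) ^ #{χ | ev χ = z} :=
        Finset.prod_comp (fun z ↦ 1 - z * X) ev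
    _ = ∏ z ∈ univ.image ev, (1 - z * X) ^ k :=
        Finset.prod_congr rfl fun z hz ↦ by rw [hfib z hz]
    _ = _ := by
        rw [Finset.prod_pow, himage, ← hroot.pow_sub_pow_eq_prod_sub_mul 1 X ht, one_pow, hk,
          Nat.mul_div_cancel_left _ ht]

end DirichletCharacter

lemma multipliable_one_sub_pow {ι : Type*} {x : ι → ℝ} (hx0 : ∀ i, 0 ≤ x i) (hx : Summable x)
    (m : ℕ) : Multipliable fun i ↦ (1 - x i) ^ m := by
  have h : Multipliable fun i ↦ 1 + -x i :=
    multipliable_one_add_of_summable (by simpa [abs_of_nonneg (hx0 _)] using hx)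
  simpa [sub_eq_add_neg] using! h.map (powMonoidHom m) (continuous_pow m)

lemma multipliable_inv_one_sub_pow {ι : Type*} {x : ι → ℝ} (hx0 : ∀ i, 0 ≤ x i)
    (hx1 : ∀ i, x i ≤ 1 / 2) (hx : Summable x) (m : ℕ) :
    Multipliable fun i ↦ ((1 - x i) ^ m)⁻¹ := by
  have h : Multipliable fun i ↦ 1 + x i / (1 - x i) := by
    refine multipliable_one_add_of_summable ((hx.mul_left 2).of_nonneg_of_le
      (fun i ↦ norm_nonneg _) fun i ↦ ?_)
    have h1 : 0 < 1 - x i := by linarith [hx1 i]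
    rw [Real.norm_of_nonneg (div_nonneg (hx0 i) h1.le), div_le_iff₀ h1]
    nlinarith [hx0 i, hx1 i]
  have h' (i : ι) : 1 + x i / (1 - x i) = (1 - x i)⁻¹ := by
    have h1 : 1 - x i ≠ 0 := by linarith [hx1 i]
    field_simp
    ring
  simp only [h'] at h
  exact (h.map (powMonoidHom m) (continuous_pow m)).congr fun i ↦ by simp

lemma prime_zpow_neg_le_half {p k : ℕ} (hp : p.Prime) (hk : 2 ≤ k) :
    (p : ℝ) ^ (-(k : ℤ)) ≤ 1 / 2 := by
  have hp2 : (2 : ℝ) ≤ p := by exact_mod_cast hp.two_le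
  rw [zpow_neg, zpow_natCast, one_div]
  exact inv_anti₀ two_pos (hp2.trans (le_self_pow₀ (by linarith) (by lia)))

lemma summable_zpow_neg {P : ℕ → Prop} {k : ℕ} (hk : 2 ≤ k) :
    Summable fun p : {p : ℕ // P p} ↦ ((p : ℕ) : ℝ) ^ (-(k : ℤ)) := by
  have : Summable fun n : ℕ ↦ (n : ℝ) ^ (-(k : ℤ)) := by
    simpa using Real.summable_nat_pow_inv.2 hk
  exact this.comp_injective Subtype.val_injective

lemma hasProd_ite_ofReal {P : ℕ → Prop} [DecidablePred P] {g : ℕ → ℝ}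
    (h : Multipliable fun p : {p : ℕ // P p} ↦ g p) :
    HasProd (fun n ↦ if P n then (g n : ℂ) else 1) ((∏' p : {p : ℕ // P p}, g p : ℝ) : ℂ) := by
  have h' := h.hasProd.map Complex.ofRealHom Complex.continuous_ofReal
  have h'' := (hasProd_subtype_iff_mulIndicator (s := {n : ℕ | P n})
    (f := fun n ↦ (g n : ℂ))).1 h'
  convert h'' using 1
  · ext n
    simp [Set.mulIndicator_apply]
  · rfl

lemma tendsto_of_tendsto_ofReal {α : Type*} {l : Filter α} [l.NeBot] {f : α → ℝ} {R : ℂ}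
    (h : Tendsto (fun x ↦ (f x : ℂ)) l (𝓝 R)) : ∃ c : ℝ, Tendsto f l (𝓝 c) ∧ (c : ℂ) = R := by
  have hre : Tendsto f l (𝓝 R.re) := (Complex.continuous_re.tendsto R).comp h
  exact ⟨R.re, hre, tendsto_nhds_unique ((Complex.continuous_ofReal.tendsto _).comp hre) h⟩

lemma two_le_exponent_units_zmod {q : ℕ} [NeZero q] (hq : 3 ≤ q) :
    2 ≤ Monoid.exponent (ZMod q)ˣ := by
  have h0 : Monoid.exponent (ZMod q)ˣ ≠ 0 := Monoid.exponent_ne_zero_of_finite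
  have h1 : Monoid.exponent (ZMod q)ˣ ≠ 1 := by
    intro h
    have := Monoid.exp_eq_one_iff.1 h
    have hfact : Fact (2 < q) := ⟨hq⟩
    exact ZMod.neg_one_ne_one (n := q) (by
      simpa using congrArg Units.val (Subsingleton.elim (-1 : (ZMod q)ˣ) 1))
  lia

lemma hasProd_ite_prime_riemannZeta_pow {k : ℕ} (hk : 2 ≤ k) (m : ℕ) :
    HasProd (fun n : ℕ ↦ if n.Prime then (((1 - (n : ℝ) ^ (-(k : ℤ))) ^ m : ℝ) : ℂ)⁻¹ else 1)
      (riemannZeta k ^ m) := by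
  have h1 : 1 < (k : ℂ).re := by
    rw [Complex.natCast_re]
    exact_mod_cast hk
  have h := (riemannZeta_eulerProduct_hasProd h1).map (powMonoidHom m) (continuous_pow m)
  rw [← Nat.Primes.hasProd_iff_hasProd_ite
    (f := fun n : ℕ ↦ (((1 - (n : ℝ) ^ (-(k : ℤ))) ^ m : ℝ) : ℂ)⁻¹)]
  convert h using 1
  · ext p
    simp [Complex.cpow_neg]
  · rfl

/-- The ratio between the Mertens factor at `n` and the product of the Euler factors at `n` of the
nonprincipal Dirichlet characters modulo `q`. -/
noncomputable def mertensCorrection (q n : ℕ) : ℝ :=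
  open scoped Classical in
  if n.Prime ∧ ¬ n ∣ q ∧ (n : ZMod q) ≠ 1 then
    ((1 - (n : ℝ) ^ (-(orderOf (n : ZMod q) : ℤ))) ^ (q.totient / orderOf (n : ZMod q)))⁻¹
  else 1

lemma two_le_orderOf_of_ne_one {G : Type*} [Group G] [Finite G] {b : G} (hb : b ≠ 1) : 2 ≤ orderOf b := by
  have h1 := orderOf_pos b
  have h2 : orderOf b ≠ 1 := fun h ↦ hb (orderOf_eq_one_iff.1 h)
  lia

lemma one_sub_zpow_neg_ne_zero {p k : ℕ} (hp : p.Prime) (hk : 2 ≤ k) :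
    1 - (p : ℝ) ^ (-(k : ℤ)) ≠ 0 := by
  linarith [prime_zpow_neg_le_half hp hk]

lemma exists_unit_eq_of_not_dvd {q p : ℕ} (hp : p.Prime) (hpq : ¬ p ∣ q) :
    ∃ u : (ZMod q)ˣ, (p : ZMod q) = u :=
  ⟨ZMod.unitOfCoprime p ((Nat.Prime.coprime_iff_not_dvd hp).2 hpq), by simp⟩

lemma not_dvd_of_eq_unit {q p : ℕ} (hp : p.Prime) {u : (ZMod q)ˣ} (h : (p : ZMod q) = u) :
    ¬ p ∣ q :=
  (Nat.Prime.coprime_iff_not_dvd hp).1 ((ZMod.isUnit_iff_coprime p q).1 (h ▸ u.isUnit))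

open scoped Classical in
lemma mertens_factor_eq {q p : ℕ} [NeZero q] (hp : p.Prime) (hpq : ¬ p ∣ q) :
    (((1 - 1 / (p : ℝ)) ^ (if (p : ZMod q) = 1 then (q.totient : ℤ) - 1 else -1) : ℝ) : ℂ) =
      (∏ χ ∈ univ.filter (fun χ : DirichletCharacter ℂ q ↦ χ ≠ 1),
        (1 - χ (p : ZMod q) * (p : ℂ)⁻¹)) * mertensCorrection q p := by
  obtain ⟨u, hu⟩ := exists_unit_eq_of_not_dvd hp hpq
  have h1 : (1 : ℂ) - (p : ℂ)⁻¹ ≠ 0 := by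
    have : (p : ℂ)⁻¹ ≠ 1 := by simpa using hp.ne_one
    exact sub_ne_zero.2 this.symm
  have hprod := DirichletCharacter.prod_one_sub_apply_mul u (p : ℂ)⁻¹
  rw [← Finset.mul_prod_erase _ _ (mem_univ 1), ← Finset.filter_ne', ← hu,
    MulChar.one_apply (hu ▸ u.isUnit), one_mul] at hprod
  rw [eq_div_of_mul_eq h1 ((mul_comm _ _).trans hprod), mertensCorrection, hu, orderOf_units]
  by_cases hu1 : u = 1
  · simp [hu1, zpow_sub₀ h1]
  · have h2 := one_sub_zpow_neg_ne_zero hp (two_le_orderOf_of_ne_one hu1)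
    have h3 : (1 : ℂ) - (p : ℂ)⁻¹ ^ orderOf u ≠ 0 := by
      simpa using Complex.ofReal_ne_zero.2 h2
    have h4 : ((1 : ℂ) - (p : ℂ)⁻¹ ^ orderOf u) ^ (q.totient / orderOf u) ≠ 0 := pow_ne_zero _ h3
    rw [if_neg (by simpa using hu1), if_pos ⟨hp, hpq, by simpa using hu1⟩]
    push_cast
    rw [zpow_neg, zpow_neg, zpow_natCast, zpow_one, one_div,
      ← inv_pow (p : ℂ), div_mul_eq_mul_div, mul_inv_cancel₀ h4, one_div]

open scoped Classical in
lemma prod_mertens_factor_eq {q : ℕ} [NeZero q] (n : ℕ) :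
    ((∏ p ∈ n.primesBelow.filter (fun p ↦ ¬ p ∣ q),
        (1 - 1 / (p : ℝ)) ^ (if (p : ZMod q) = 1 then (q.totient : ℤ) - 1 else -1) : ℝ) : ℂ) =
      (∏ χ ∈ univ.filter (fun χ : DirichletCharacter ℂ q ↦ χ ≠ 1),
        ∏ p ∈ n.primesBelow, (1 - χ (p : ZMod q) * (p : ℂ)⁻¹)) *
      ∏ p ∈ range n, (mertensCorrection q p : ℂ) := by
  have hrange : ∏ p ∈ range n, (mertensCorrection q p : ℂ) =
      ∏ p ∈ n.primesBelow, (mertensCorrection q p : ℂ) := by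
    rw [Nat.primesBelow, Finset.prod_filter]
    refine Finset.prod_congr rfl fun p _ ↦ ?_
    split_ifs with hp
    · rfl
    · simp [mertensCorrection, hp]
  rw [hrange, Finset.prod_comm, ← Finset.prod_mul_distrib, Complex.ofReal_prod,
    Finset.prod_filter]
  refine Finset.prod_congr rfl fun p hp ↦ ?_
  have hp' := Nat.prime_of_mem_primesBelow hp
  by_cases hpq : p ∣ q
  swap
  · rw [if_pos hpq, mertens_factor_eq hp' hpq]
  · have hnu : ¬ IsUnit (p : ZMod q) := by
      rw [ZMod.isUnit_iff_coprime, Nat.Prime.coprime_iff_not_dvd hp']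
      exact not_not.2 hpq
    rw [Finset.prod_eq_one fun χ _ ↦ by rw [MulChar.map_nonunit χ hnu]; simp]
    simp [mertensCorrection, hpq]

lemma multipliable_one_sub_zpow_neg_pow {P : ℕ → Prop} {k : ℕ} (hk : 2 ≤ k) (m : ℕ) :
    Multipliable fun p : {p : ℕ // P p} ↦ (1 - ((p : ℕ) : ℝ) ^ (-(k : ℤ))) ^ m :=
  multipliable_one_sub_pow (fun _ ↦ by positivity) (summable_zpow_neg hk) m

lemma multipliable_one_sub_zpow_neg_mul {P : ℕ → Prop} {k l : ℕ} (hl : 2 ≤ l) (hk : 2 ≤ k) (m n : ℕ) :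
    Multipliable fun p : {p : ℕ // p.Prime ∧ P p} ↦
      (1 - ((p : ℕ) : ℝ) ^ (-(l : ℤ))) ^ (-(n : ℤ)) * (1 - ((p : ℕ) : ℝ) ^ (-(k : ℤ))) ^ m := by
  refine Multipliable.mul ?_ (multipliable_one_sub_zpow_neg_pow hk m)
  simp only [zpow_neg _ (n : ℤ), zpow_natCast _ n]
  exact multipliable_inv_one_sub_pow (fun _ ↦ by positivity)
    (fun p ↦ prime_zpow_neg_le_half p.2.1 hl) (summable_zpow_neg hl) n

open scoped Classical in
lemma hasProd_mertensCorrection {q : ℕ} [NeZero q] {k : ℕ} (hk : Monoid.exponent (ZMod q)ˣ = k)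
    (hk2 : 2 ≤ k) :
    HasProd (fun n : ℕ ↦ (mertensCorrection q n : ℂ))
      (riemannZeta k ^ (q.totient / k) *
        (((∏ p ∈ q.primeFactors, (1 - (p : ℝ) ^ (-(k : ℤ))) ^ (q.totient / k)) *
          (∏' p : {p : ℕ // p.Prime ∧ ((p : ℕ) : ZMod q) = 1},
            (1 - ((p : ℕ) : ℝ) ^ (-(k : ℤ))) ^ (q.totient / k)) *
          ∏ b ∈ Finset.univ.filter (fun b : (ZMod q)ˣ ↦ b ≠ 1 ∧ orderOf b < k),
            ∏' p : {p : ℕ // p.Prime ∧ ((p : ℕ) : ZMod q) = (b : ZMod q)},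
              (1 - ((p : ℕ) : ℝ) ^ (-(orderOf b : ℤ))) ^ (-((q.totient / orderOf b : ℕ) : ℤ)) *
                (1 - ((p : ℕ) : ℝ) ^ (-(k : ℤ))) ^ (q.totient / k) : ℝ) : ℂ)) := by
  set m := q.totient / k
  let h (n : ℕ) : ℝ := (1 - (n : ℝ) ^ (-(k : ℤ))) ^ m
  let g (b : (ZMod q)ˣ) (n : ℕ) : ℝ :=
    (1 - (n : ℝ) ^ (-(orderOf b : ℤ))) ^ (-((q.totient / orderOf b : ℕ) : ℤ)) * h n
  have hzeta := hasProd_ite_prime_riemannZeta_pow hk2 m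
  have hfactors : HasProd (fun n ↦ if n ∈ q.primeFactors then (h n : ℂ) else 1)
      (∏ p ∈ q.primeFactors, (h p : ℂ)) := by
    convert hasProd_prod_of_ne_finset_one (s := q.primeFactors)
      (L := SummationFilter.unconditional ℕ)
      (f := fun n ↦ if n ∈ q.primeFactors then (h n : ℂ) else 1) (fun n hn ↦ if_neg hn) using 1
    exact Finset.prod_congr rfl fun p hp ↦ (if_pos hp).symm
  have hone := hasProd_ite_ofReal (P := fun p ↦ p.Prime ∧ (p : ZMod q) = 1) (g := h)
    (multipliable_one_sub_zpow_neg_pow hk2 m)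
  have hresidue := hasProd_prod (L := SummationFilter.unconditional ℕ)
    (s := Finset.univ.filter (fun b : (ZMod q)ˣ ↦ b ≠ 1 ∧ orderOf b < k))
    fun b hb ↦ hasProd_ite_ofReal (P := fun p ↦ p.Prime ∧ (p : ZMod q) = b) (g := g b)
      (multipliable_one_sub_zpow_neg_mul (two_le_orderOf_of_ne_one (Finset.mem_filter.1 hb).2.1) hk2 m _)
  convert hzeta.mul ((hfactors.mul hone).mul hresidue) using 1
  · ext n
    by_cases hn : n.Prime
    swap
    · have : n ∉ q.primeFactors := fun h ↦ hn (Nat.prime_of_mem_primeFactors h)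
      simp [mertensCorrection, hn, this]
    have hh : (h n : ℂ) ≠ 0 :=
      Complex.ofReal_ne_zero.2 (pow_ne_zero _ (one_sub_zpow_neg_ne_zero hn hk2))
    by_cases hnq : n ∣ q
    · have hunit (b : (ZMod q)ˣ) : (n : ZMod q) ≠ b := fun h ↦ not_dvd_of_eq_unit hn h hnq
      have hne : (n : ZMod q) ≠ 1 := by simpa using hunit 1
      have hmem : n ∈ q.primeFactors := Nat.mem_primeFactors.2 ⟨hn, hnq, NeZero.ne q⟩
      simp only [hn, hmem, hne, hunit, if_true, if_false, and_false, Finset.prod_const_one, mul_one]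
      rw [inv_mul_cancel₀ hh]
      simp [mertensCorrection, hnq]
    · obtain ⟨u, hu⟩ := exists_unit_eq_of_not_dvd hn hnq
      have hmem : n ∉ q.primeFactors := fun h ↦ hnq (Nat.dvd_of_mem_primeFactors h)
      have hprod : ∏ b ∈ Finset.univ.filter (fun b : (ZMod q)ˣ ↦ b ≠ 1 ∧ orderOf b < k),
          (if n.Prime ∧ (n : ZMod q) = b then (g b n : ℂ) else 1) =
          if u ≠ 1 ∧ orderOf u < k then (g u n : ℂ) else 1 := by
        simp only [hn, hu, true_and, Units.val_inj, Finset.prod_ite_eq, Finset.mem_filter,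
          Finset.mem_univ]
      rw [hprod, if_pos hn, if_neg hmem, one_mul]
      by_cases hu1 : u = 1
      · have hn1 : (n : ZMod q) = 1 := by simp [hu, hu1]
        rw [if_pos ⟨hn, hn1⟩, if_neg (by simp [hu1]), mul_one, inv_mul_cancel₀ hh]
        simp [mertensCorrection, hn1]
      · have hn1 : (n : ZMod q) ≠ 1 := by simpa [hu] using hu1
        rw [if_neg (fun h ↦ hn1 h.2), one_mul, mertensCorrection, if_pos ⟨hn, hnq, hn1⟩, hu,
          orderOf_units]
        by_cases hlt : orderOf u < k
        · rw [if_pos ⟨hu1, hlt⟩, mul_comm, Complex.ofReal_mul, mul_assoc, mul_inv_cancel₀ hh,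
            mul_one, zpow_neg _ ((q.totient / orderOf u : ℕ) : ℤ),
            zpow_natCast _ (q.totient / orderOf u)]
        · have hle : orderOf u ≤ k :=
            Nat.le_of_dvd (by lia) (hk ▸ Monoid.order_dvd_exponent u)
          rw [if_neg (fun h ↦ hlt h.2), mul_one, le_antisymm hle (not_lt.1 hlt),
            Complex.ofReal_inv]
  · push_cast [h, g]
    rfl

open scoped Classical in
/-- **Theorem (general formula for `c(q, 1)`).**
For `q ≥ 3`, with `λ(q)` the exponent of `(ℤ/qℤ)ˣ` (Carmichael's function),
`t_b` the order of `b`, and `𝒜(q) = {b ≠ 1 : t_b < λ(q)}`, the limit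
`c(q,1) = lim_{x→∞} ∏_{p ≤ x, p ∤ q} (1 - 1/p)^{α(p;q,1)}` exists and equals
`ζ(λ(q))^{φ(q)/λ(q)} Π(q,1) ∏_{p ∣ q} (1 - p^{-λ(q)})^{φ(q)/λ(q)}
  ∏_{p ≡ 1 (q)} (1 - p^{-λ(q)})^{φ(q)/λ(q)}
  ∏_{b ∈ 𝒜(q)} ∏_{p ≡ b (q)} {(1 - p^{-t_b})^{-φ(q)/t_b} (1 - p^{-λ(q)})^{φ(q)/λ(q)}}`,
with all products over primes in residue classes absolutely convergent and
`Π(q,1) = ∏_{χ ≠ χ₀} L(1,χ)⁻¹`. -/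
theorem mertens_constant_general_formula (q : ℕ) [NeZero q] (hq : 3 ≤ q) :
    ∃ c : ℝ,
      Tendsto (fun x : ℝ =>
          ∏ p ∈ (Nat.floor x + 1).primesBelow.filter (fun p => ¬ p ∣ q),
            (1 - 1 / (p : ℝ)) ^
              (if (p : ZMod q) = 1 then (q.totient : ℤ) - 1 else -1))
        atTop (𝓝 c) ∧
      Multipliable (fun p : {p : ℕ // p.Prime ∧ ((p : ℕ) : ZMod q) = 1} =>
        (1 - ((p : ℕ) : ℝ) ^ (-(Monoid.exponent (ZMod q)ˣ : ℤ))) ^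
          (q.totient / Monoid.exponent (ZMod q)ˣ)) ∧
      (∀ b : (ZMod q)ˣ, b ≠ 1 → orderOf b < Monoid.exponent (ZMod q)ˣ →
        Multipliable (fun p : {p : ℕ // p.Prime ∧ ((p : ℕ) : ZMod q) = (b : ZMod q)} =>
          (1 - ((p : ℕ) : ℝ) ^ (-(orderOf b : ℤ))) ^
              (-((q.totient / orderOf b : ℕ) : ℤ)) *
            (1 - ((p : ℕ) : ℝ) ^ (-(Monoid.exponent (ZMod q)ˣ : ℤ))) ^
              (q.totient / Monoid.exponent (ZMod q)ˣ))) ∧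
      (c : ℂ) =
        riemannZeta (Monoid.exponent (ZMod q)ˣ) ^ (q.totient / Monoid.exponent (ZMod q)ˣ) *
          (∏ χ ∈ Finset.univ.filter (fun χ : DirichletCharacter ℂ q => χ ≠ 1),
            (DirichletCharacter.LFunction χ 1)⁻¹) *
          (((∏ p ∈ q.primeFactors,
              (1 - (p : ℝ) ^ (-(Monoid.exponent (ZMod q)ˣ : ℤ))) ^
                (q.totient / Monoid.exponent (ZMod q)ˣ)) *
            (∏' p : {p : ℕ // p.Prime ∧ ((p : ℕ) : ZMod q) = 1},
              (1 - ((p : ℕ) : ℝ) ^ (-(Monoid.exponent (ZMod q)ˣ : ℤ))) ^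
                (q.totient / Monoid.exponent (ZMod q)ˣ)) *
            ∏ b ∈ Finset.univ.filter
                (fun b : (ZMod q)ˣ => b ≠ 1 ∧ orderOf b < Monoid.exponent (ZMod q)ˣ),
              ∏' p : {p : ℕ // p.Prime ∧ ((p : ℕ) : ZMod q) = (b : ZMod q)},
                (1 - ((p : ℕ) : ℝ) ^ (-(orderOf b : ℤ))) ^
                    (-((q.totient / orderOf b : ℕ) : ℤ)) *
                  (1 - ((p : ℕ) : ℝ) ^ (-(Monoid.exponent (ZMod q)ˣ : ℤ))) ^
                    (q.totient / Monoid.exponent (ZMod q)ˣ) : ℝ) : ℂ) := by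
  have hk := two_le_exponent_units_zmod hq
  have hprod := hasProd_mertensCorrection rfl hk
  have hfloor : Tendsto (fun x : ℝ ↦ ⌊x⌋₊ + 1) atTop atTop :=
    (tendsto_add_atTop_nat 1).comp tendsto_nat_floor_atTop
  have hL : Tendsto (fun n : ℕ ↦ ∏ χ ∈ univ.filter (fun χ : DirichletCharacter ℂ q ↦ χ ≠ 1),
      ∏ p ∈ n.primesBelow, (1 - χ (p : ZMod q) * (p : ℂ)⁻¹)) atTop
      (𝓝 (∏ χ ∈ univ.filter (fun χ : DirichletCharacter ℂ q ↦ χ ≠ 1),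
        (DirichletCharacter.LFunction χ 1)⁻¹)) :=
    tendsto_finsetProd _ fun χ hχ ↦
      DirichletCharacter.tendsto_prod_primesBelow_eulerFactor_one (Finset.mem_filter.1 hχ).2
  have hlim := (hL.mul hprod.tendsto_prod_nat).comp hfloor
  simp only [Function.comp_def, ← prod_mertens_factor_eq] at hlim
  obtain ⟨c, hc, hceq⟩ := tendsto_of_tendsto_ofReal hlim
  refine ⟨c, hc, multipliable_one_sub_zpow_neg_pow hk _, fun b hb _ ↦
    multipliable_one_sub_zpow_neg_mul (two_le_orderOf_of_ne_one hb) hk _ _, ?_⟩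
  rw [hceq]
  ring
end

section
/- As x → ∞, (log x) · ( ∏_{p ≤ x, p ≡ 1 (mod 4)} (1 − 1/p) )² tends to π · e^{−γ} · ∏_{p ≡ 1 (mod 4)} (1 − 1/p²), where the last product over all primes p ≡ 1 (mod 4) is absolutely convergent. Equivalently, Uchiyama's formula C(4,1)² = π e^{−γ} ∏_{p ≡ 1 (mod 4)} (1 − 1/p²) holds. -/
open Filter Topology Finset

/-- The nonprincipal character modulo `4`, with real values. -/
noncomputable def chiFour (n : ℕ) : ℝ := ((ZMod.χ₄ n : ℤ) : ℝ)

lemma chiFour_eq (n : ℕ) :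
    chiFour n = if n % 2 = 0 then 0 else if n % 4 = 1 then 1 else -1 := by
  unfold chiFour
  rw [ZMod.χ₄_nat_eq_if_mod_four]
  split_ifs <;> simp

lemma chiFour_mul (m n : ℕ) : chiFour (m * n) = chiFour m * chiFour n := by
  rw [chiFour, chiFour, chiFour, Nat.cast_mul, map_mul, Int.cast_mul]

lemma abs_chiFour_le_one (n : ℕ) : |chiFour n| ≤ 1 := by
  rw [chiFour_eq]; split_ifs <;> simp

lemma sum_range_chiFour (n : ℕ) :
    ∑ i ∈ range (n + 1), chiFour i = if n % 4 = 1 ∨ n % 4 = 2 then 1 else 0 := by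
  induction n with
  | zero => simp [chiFour_eq]
  | succ n ih =>
    rw [sum_range_succ, ih, chiFour_eq]
    split_ifs <;> first | omega | norm_num

lemma tendsto_sum_chiFour_div_even :
    Tendsto (fun k : ℕ => ∑ n ∈ range (2 * k + 1), chiFour n / n) atTop (𝓝 (Real.pi / 4)) := by
  refine Real.tendsto_sum_pi_div_four.congr fun k => ?_
  induction k with
  | zero => simp
  | succ k ih =>
    rw [sum_range_succ, ih, show 2 * (k + 1) + 1 = 2 * k + 1 + 1 + 1 by ring,
      sum_range_succ _ (2 * k + 1 + 1), sum_range_succ _ (2 * k + 1)]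
    have h1 : chiFour (2 * k + 1 + 1) = 0 := by rw [chiFour_eq, if_pos (by omega)]
    have h2 : chiFour (2 * k + 1) = (-1) ^ k := by
      rw [chiFour, ZMod.χ₄_eq_neg_one_pow (by omega), show (2 * k + 1) / 2 = k by omega]
      simp
    rw [h1, h2]; push_cast; ring

/-- The partial sums of `L(1, χ₄)`, with an error term. -/
lemma abs_sum_chiFour_div_sub_le (k : ℕ) :
    |∑ n ∈ range (k + 1), chiFour n / n - Real.pi / 4| ≤ 1 / (k + 1) := by
  set S : ℕ → ℝ := fun k => ∑ n ∈ range (k + 1), chiFour n / n with hS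
  set X : ℕ → ℝ := fun k => ∑ n ∈ range (k + 1), chiFour n with hX
  have hX01 (k : ℕ) : 0 ≤ X k ∧ X k ≤ 1 := by
    simp only [hX, sum_range_chiFour]; split_ifs <;> norm_num
  set E : ℕ → ℝ := fun k => S k - X k / (k + 1) with hE
  have hstep (k : ℕ) : E (k + 1) - E k = X (k + 1) * (1 / (k + 1) - 1 / (k + 1 + 1)) := by
    have h1 : S (k + 1) = S k + chiFour (k + 1) / (k + 1) := by
      simp only [hS]; rw [sum_range_succ]; push_cast; rfl
    have h2 : X (k + 1) = X k + chiFour (k + 1) := by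
      simp only [hX]; rw [sum_range_succ]
    simp only [hE, h1]
    rw [show chiFour (k + 1) = X (k + 1) - X k by rw [h2]; ring]
    push_cast; field_simp; ring
  have hpos (k : ℕ) : (0 : ℝ) ≤ 1 / (k + 1) - 1 / (k + 1 + 1) := by
    rw [sub_nonneg]; gcongr; linarith
  have hmono : Monotone E := monotone_nat_of_le_succ fun k => by
    have := mul_nonneg (hX01 (k + 1)).1 (hpos k)
    linarith [hstep k]
  have hanti : Antitone fun k : ℕ => E k + 1 / (k + 1 : ℝ) := antitone_nat_of_succ_le fun k => by
    have := mul_le_mul_of_nonneg_right (hX01 (k + 1)).2 (hpos k)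
    push_cast
    linarith [hstep k]
  have hone : Tendsto (fun k : ℕ => 1 / (k + 1 : ℝ)) atTop (𝓝 0) :=
    tendsto_one_div_add_atTop_nhds_zero_nat
  have htwo : Tendsto (fun k : ℕ => 2 * k) atTop atTop :=
    tendsto_id.const_mul_atTop' (by norm_num)
  have hEL : Tendsto (fun k : ℕ => E (2 * k)) atTop (𝓝 (Real.pi / 4)) := by
    have h0 : Tendsto (fun k : ℕ => X k / (k + 1 : ℝ)) atTop (𝓝 0) :=
      squeeze_zero (fun k => div_nonneg (hX01 k).1 (by positivity))
        (fun k => by gcongr; exact (hX01 k).2) hone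
    simpa [hE] using tendsto_sum_chiFour_div_even.sub (h0.comp htwo)
  have hlow : E k ≤ Real.pi / 4 := by
    refine ge_of_tendsto hEL ?_
    filter_upwards [eventually_ge_atTop k] with m hm
    exact hmono (by omega)
  have hup : Real.pi / 4 ≤ E k + 1 / (k + 1) := by
    have := hEL.add (hone.comp htwo)
    rw [add_zero] at this
    refine le_of_tendsto this ?_
    filter_upwards [eventually_ge_atTop k] with m hm
    exact hanti (show k ≤ 2 * m by omega)
  have hk : (0 : ℝ) < k + 1 := by positivity
  have h1 : X k / (k + 1) ≤ 1 / (k + 1) := by gcongr; exact (hX01 k).2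
  have h2 : 0 ≤ X k / (k + 1) := div_nonneg (hX01 k).1 hk.le
  have h3 : S k = E k + X k / (k + 1) := by simp [hE]
  rw [abs_le]
  constructor <;> linarith

lemma tendsto_sum_chiFour_div :
    Tendsto (fun k : ℕ => ∑ n ∈ range (k + 1), chiFour n / n) atTop (𝓝 (Real.pi / 4)) := by
  rw [tendsto_iff_dist_tendsto_zero]
  exact squeeze_zero (fun _ => dist_nonneg) abs_sum_chiFour_div_sub_le
    tendsto_one_div_add_atTop_nhds_zero_nat

lemma exists_abs_sum_chiFour_mul_log_div_le :
    ∃ C, ∀ N : ℕ, |∑ n ∈ range (N + 1), chiFour n * Real.log n / n| ≤ C := by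
  have hcauchy := Antitone.cauchySeq_series_mul_of_tendsto_zero_of_bounded (b := 2)
    (f := fun i : ℕ => Real.log (i + 3 : ℕ) / (i + 3 : ℕ)) (z := fun i => chiFour (i + 3)) ?_ ?_ ?_
  · obtain ⟨l, hl⟩ := cauchySeq_tendsto_of_complete hcauchy
    have hlim : Tendsto (fun N : ℕ => ∑ n ∈ range (N + 3), chiFour n * Real.log n / n) atTop
        (𝓝 (l + ∑ n ∈ range 3, chiFour n * Real.log n / n)) := by
      refine (hl.add_const _).congr fun N => ?_
      rw [add_comm N 3, sum_range_add, add_comm]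
      congr 1
      refine sum_congr rfl fun i _ => ?_
      rw [add_comm 3 i, smul_eq_mul]; ring
    have hlim' : Tendsto (fun N : ℕ => ∑ n ∈ range (N + 1), chiFour n * Real.log n / n) atTop
        (𝓝 (l + ∑ n ∈ range 3, chiFour n * Real.log n / n)) := by
      rw [← tendsto_add_atTop_iff_nat 2]; exact hlim
    obtain ⟨C, hC⟩ := (Metric.isBounded_range_of_tendsto _ hlim').exists_norm_le
    exact ⟨C, fun N => hC _ ⟨N, rfl⟩⟩
  · intro a b hab
    have h3 (i : ℕ) : Real.exp 1 ≤ ((i + 3 : ℕ) : ℝ) := by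
      have := Real.exp_one_lt_d9
      push_cast
      have : (0 : ℝ) ≤ i := by positivity
      linarith
    exact Real.log_div_self_antitoneOn (h3 a) (h3 b) (by exact_mod_cast (by omega))
  · have h : Tendsto (fun x : ℝ => Real.log x / x) atTop (𝓝 0) :=
      Real.isLittleO_log_id_atTop.tendsto_div_nhds_zero
    exact h.comp (tendsto_natCast_atTop_atTop.comp (tendsto_add_atTop_nat 3))
  · intro n
    have h := sum_range_add (fun i => chiFour i) 3 n
    simp only [add_comm 3] at h
    rw [show ∑ i ∈ range n, chiFour (i + 3) = ∑ i ∈ range (n + 2 + 1), chiFour i -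
      ∑ i ∈ range (2 + 1), chiFour i by rw [h]; ring]
    rw [sum_range_chiFour, sum_range_chiFour, Real.norm_eq_abs]
    split_ifs <;> norm_num

open ArithmeticFunction in
lemma sum_vonMangoldt_range_le :
    ∃ C, 0 ≤ C ∧ ∀ N : ℕ, ∑ n ∈ Ioc 0 N, vonMangoldt n ≤ C * N := by
  refine ⟨Real.log 4 + 4, by positivity, fun N => ?_⟩
  have := Chebyshev.psi_le_const_mul_self (x := N) (by positivity)
  simpa [Chebyshev.psi] using this

lemma sum_range_succ_eq_sum_Ioc {f : ℕ → ℝ} (h0 : f 0 = 0) (N : ℕ) :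
    ∑ n ∈ range (N + 1), f n = ∑ n ∈ Ioc 0 N, f n := by
  rw [sum_range_succ', h0, add_zero, range_eq_Ico, sum_Ico_add' f 0 N 1]
  rfl

open ArithmeticFunction in
lemma exists_abs_sum_chiFour_mul_vonMangoldt_div_le :
    ∃ C, ∀ N : ℕ, |∑ n ∈ range (N + 1), chiFour n * vonMangoldt n / n| ≤ C := by
  obtain ⟨C₁, hC₁⟩ := exists_abs_sum_chiFour_mul_log_div_le
  obtain ⟨C₂, hC₂, hC₂'⟩ := sum_vonMangoldt_range_le
  refine ⟨(C₁ + C₂) / (Real.pi / 4), fun N => ?_⟩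
  have hpi : 0 < Real.pi / 4 := by positivity
  rw [le_div_iff₀ hpi, ← abs_of_pos hpi, ← abs_mul]
  rcases N.eq_zero_or_pos with rfl | hN
  · have := (abs_nonneg _).trans (hC₁ 0)
    simp; positivity
  let f : ArithmeticFunction ℝ := ⟨fun n => chiFour n * vonMangoldt n / n, by simp⟩
  let g : ArithmeticFunction ℝ := ⟨fun n => chiFour n / n, by simp⟩
  have hfg (n : ℕ) : (f * g) n = chiFour n * Real.log n / n := by
    rw [ArithmeticFunction.mul_apply, ← vonMangoldt_sum,
      Nat.sum_divisorsAntidiagonal' (f := fun a b => f a * g b), mul_sum, sum_div,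
      ← Nat.sum_div_divisors n (fun i => chiFour n * vonMangoldt i / n)]
    refine sum_congr rfl fun d hd => ?_
    have hd0 : (d : ℝ) ≠ 0 := by
      have := Nat.pos_of_mem_divisors hd
      positivity
    obtain ⟨⟨e, rfl⟩, hn⟩ := Nat.mem_divisors.1 hd
    have he : (e : ℝ) ≠ 0 := by
      rintro h; apply hn; simp at h; simp [h]
    have hd1 : 0 < d := Nat.pos_of_mem_divisors hd
    rw [Nat.mul_div_cancel_left _ hd1]
    simp only [f, g, ArithmeticFunction.coe_mk, chiFour_mul]
    push_cast
    field_simp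
  have hsum := sum_Ioc_mul_eq_sum_sum f g N
  have hLHS : |∑ n ∈ Ioc 0 N, (f * g) n| ≤ C₁ := by
    simp only [hfg]
    rw [← sum_range_succ_eq_sum_Ioc (by simp)]
    exact hC₁ N
  have hdiff : |∑ n ∈ Ioc 0 N, f n * (∑ m ∈ Ioc 0 (N / n), g m - Real.pi / 4)| ≤ C₂ := by
    have hNr : (0 : ℝ) < N := by positivity
    calc _ ≤ ∑ n ∈ Ioc 0 N, |f n * (∑ m ∈ Ioc 0 (N / n), g m - Real.pi / 4)| :=
          abs_sum_le_sum_abs _ _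
      _ ≤ ∑ n ∈ Ioc 0 N, vonMangoldt n / N := by
          refine sum_le_sum fun n hn => ?_
          have hn0 : 0 < n := (mem_Ioc.1 hn).1
          have hg : |∑ m ∈ Ioc 0 (N / n), g m - Real.pi / 4| ≤ n / N := by
            rw [← sum_range_succ_eq_sum_Ioc (by simp)]
            refine (abs_sum_chiFour_div_sub_le (N / n)).trans ?_
            rw [div_le_div_iff₀ (by positivity) hNr, one_mul]
            exact_mod_cast (Nat.lt_mul_div_succ N hn0).le
          have hf : |f n| ≤ vonMangoldt n / n := by
            simp only [f, ArithmeticFunction.coe_mk]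
            rw [abs_div, abs_mul, Nat.abs_cast, abs_of_nonneg (vonMangoldt_nonneg (n := n))]
            gcongr
            exact mul_le_of_le_one_left vonMangoldt_nonneg (abs_chiFour_le_one n)
          rw [abs_mul]
          calc _ ≤ vonMangoldt n / n * (n / N) := by
                gcongr
            _ = _ := by field_simp
      _ ≤ C₂ := by
          rw [← sum_div, div_le_iff₀ hNr]
          exact hC₂' N
  simp only [mul_sub, sum_sub_distrib] at hdiff
  rw [← hsum, ← sum_mul] at hdiff
  rw [sum_range_succ_eq_sum_Ioc (by simp)]
  change |(∑ n ∈ Ioc 0 N, f n) * _| ≤ _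
  rw [abs_le] at *
  constructor <;> linarith [hLHS.1, hLHS.2, hdiff.1, hdiff.2]

lemma abs_log_factorial_sub_le (N : ℕ) :
    |∑ n ∈ Ioc 0 N, Real.log n - N * Real.log N| ≤ N := by
  have hfac : ∑ n ∈ Ioc 0 N, Real.log n = Real.log N.factorial := by
    induction N with
    | zero => simp
    | succ n ih =>
      rw [Finset.sum_Ioc_succ_top (by omega), ih, Nat.factorial_succ, Nat.cast_mul,
        Real.log_mul (by positivity) (by positivity)]
      ring
  rcases N.eq_zero_or_pos with rfl | hN
  · simp
  have hup : Real.log N.factorial ≤ N * Real.log N := by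
    rw [← Real.log_pow]
    exact Real.log_le_log (by positivity) (by exact_mod_cast N.factorial_le_pow)
  have hlow : N * Real.log N - N ≤ Real.log N.factorial := by
    have h := Stirling.le_log_factorial_stirling hN.ne'
    have h1 : 0 ≤ Real.log N := Real.log_natCast_nonneg N
    have h2 : 0 ≤ Real.log (2 * Real.pi) :=
      Real.log_nonneg (by linarith [Real.pi_gt_three])
    linarith
  rw [hfac, abs_le]
  constructor <;> linarith

open ArithmeticFunction in
lemma exists_abs_sum_vonMangoldt_div_sub_log_le :
    ∃ C, ∀ N : ℕ, |∑ n ∈ range (N + 1), vonMangoldt n / n - Real.log N| ≤ C := by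
  obtain ⟨C₂, hC₂, hC₂'⟩ := sum_vonMangoldt_range_le
  refine ⟨1 + C₂, fun N => ?_⟩
  rw [sum_range_succ_eq_sum_Ioc (by simp)]
  rcases N.eq_zero_or_pos with rfl | hN
  · simp; positivity
  have hNr : (0 : ℝ) < N := by positivity
  have hsum : ∑ n ∈ Ioc 0 N, vonMangoldt n * ((N / n : ℕ) : ℝ) = ∑ n ∈ Ioc 0 N, Real.log n := by
    rw [← sum_Ioc_mul_zeta_eq_sum, vonMangoldt_mul_zeta]
    rfl
  have hlow : ∑ n ∈ Ioc 0 N, vonMangoldt n * ((N / n : ℕ) : ℝ)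
      ≤ N * ∑ n ∈ Ioc 0 N, vonMangoldt n / n := by
    rw [mul_sum]
    refine sum_le_sum fun n hn => ?_
    calc _ ≤ vonMangoldt n * ((N : ℝ) / n) := by
          gcongr
          exact Nat.cast_div_le
      _ = _ := by ring
  have hup : N * ∑ n ∈ Ioc 0 N, vonMangoldt n / n
      ≤ ∑ n ∈ Ioc 0 N, vonMangoldt n * ((N / n : ℕ) : ℝ) + C₂ * N := by
    refine le_trans ?_ (add_le_add_right (hC₂' N) _)
    rw [mul_sum, ← sum_add_distrib]
    refine sum_le_sum fun n hn => ?_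
    have hn0 : 0 < n := (mem_Ioc.1 hn).1
    have hnr : (0 : ℝ) < n := by positivity
    calc _ = vonMangoldt n * ((N : ℝ) / n) := by ring
      _ ≤ vonMangoldt n * (((N / n : ℕ) : ℝ) + 1) := by
          gcongr
          rw [div_le_iff₀' hnr]
          exact_mod_cast (Nat.lt_mul_div_succ N hn0).le
      _ = _ := by ring
  have hfac := abs_le.1 (abs_log_factorial_sub_le N)
  rw [hsum] at hlow hup
  rw [abs_le]
  constructor
  · refine le_of_mul_le_mul_left ?_ hNr
    nlinarith
  · refine le_of_mul_le_mul_left ?_ hNr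
    nlinarith

open ArithmeticFunction in
lemma exists_abs_sum_one_add_chiFour_mul_vonMangoldt_le :
    ∃ C, ∀ N : ℕ, |∑ n ∈ range (N + 1), ((1 + chiFour n) * vonMangoldt n - 1) / n| ≤ C := by
  obtain ⟨C₁, hC₁⟩ := exists_abs_sum_chiFour_mul_vonMangoldt_div_le
  obtain ⟨C₂, hC₂⟩ := exists_abs_sum_vonMangoldt_div_sub_log_le
  refine ⟨C₁ + C₂ + 1, fun N => ?_⟩
  have hharm : |∑ n ∈ range (N + 1), (1 : ℝ) / n - Real.log N| ≤ 1 := by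
    have h : ∑ n ∈ range (N + 1), (1 : ℝ) / n = (harmonic N : ℚ) := by
      rw [sum_range_succ', harmonic]; push_cast; simp
    rw [h, abs_le]
    have h1 := harmonic_le_one_add_log N
    have h2 := log_add_one_le_harmonic N
    rcases N.eq_zero_or_pos with rfl | hN
    · simp
    have h3 : Real.log N ≤ Real.log ↑(N + 1) :=
      Real.log_le_log (by positivity) (by push_cast; linarith)
    constructor <;> linarith
  have hsplit : ∑ n ∈ range (N + 1), ((1 + chiFour n) * vonMangoldt n - 1) / n =
      ∑ n ∈ range (N + 1), chiFour n * vonMangoldt n / n +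
        (∑ n ∈ range (N + 1), vonMangoldt n / n - Real.log N) -
        (∑ n ∈ range (N + 1), (1 : ℝ) / n - Real.log N) := by
    rw [show ∀ a b c d : ℝ, a + (b - d) - (c - d) = a + b - c by intros; ring,
      ← sum_add_distrib, ← sum_sub_distrib]
    exact sum_congr rfl fun n _ => by ring
  rw [hsplit]
  have h1 := abs_le.1 (hC₁ N)
  have h2 := abs_le.1 (hC₂ N)
  have h3 := abs_le.1 hharm
  rw [abs_le]
  constructor <;> linarith [h1.1, h1.2, h2.1, h2.2]

lemma abs_log_one_add_sub_log_one_sub_sub_le {y : ℝ} (h0 : 0 ≤ y) (h1 : y ≤ 1 / 2) :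
    |Real.log (1 + y) - Real.log (1 - y) - 2 * y| ≤ 4 * y ^ 2 := by
  have key (x : ℝ) (hx : |x| = y) : |x + Real.log (1 - x)| ≤ 2 * y ^ 2 := by
    have h := Real.abs_log_sub_add_sum_range_le (x := x) (by rw [hx]; linarith) 1
    rw [hx] at h
    simp only [sum_range_one, zero_add, pow_one, Nat.cast_zero, div_one] at h
    refine h.trans ?_
    rw [div_le_iff₀ (by linarith), one_add_one_eq_two]
    nlinarith [mul_nonneg (sq_nonneg y) (show 0 ≤ 1 - 2 * y by linarith)]
  have h2 := abs_le.1 (key y (abs_of_nonneg h0))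
  have h3 := abs_le.1 (key (-y) (by rw [abs_neg, abs_of_nonneg h0]))
  rw [sub_neg_eq_add] at h3
  rw [abs_le]
  constructor <;> linarith [h2.1, h2.2, h3.1, h3.2]

/-- The logarithm of the local factor `(1 + p⁻ˢ) / (1 - p⁻ˢ)` at a prime `p ≡ 1 (mod 4)`. -/
noncomputable def logFactor (s : ℝ) (n : ℕ) : ℝ :=
  if n.Prime ∧ n % 4 = 1 then Real.log (1 + (n : ℝ) ^ (-s)) - Real.log (1 - (n : ℝ) ^ (-s)) else 0

lemma rpow_neg_le_inv {n : ℕ} (hn : 1 ≤ n) {s : ℝ} (hs : 1 ≤ s) : (n : ℝ) ^ (-s) ≤ (n : ℝ)⁻¹ := by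
  rw [← Real.rpow_neg_one]
  exact Real.rpow_le_rpow_of_exponent_le (by exact_mod_cast hn) (by linarith)

lemma rpow_neg_le_half {n : ℕ} (hn : 2 ≤ n) {s : ℝ} (hs : 1 ≤ s) : (n : ℝ) ^ (-s) ≤ 1 / 2 := by
  refine (rpow_neg_le_inv (by omega) hs).trans ?_
  rw [inv_eq_one_div]
  gcongr
  exact_mod_cast hn

lemma abs_logFactor_sub_le {n : ℕ} (hn : n.Prime ∧ n % 4 = 1) {s : ℝ} (hs : 1 ≤ s) :
    |logFactor s n - 2 * (n : ℝ) ^ (-s)| ≤ 4 * ((n : ℝ) ^ 2)⁻¹ := by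
  rw [logFactor, if_pos hn]
  refine (abs_log_one_add_sub_log_one_sub_sub_le (by positivity)
    (rpow_neg_le_half hn.1.two_le hs)).trans ?_
  rw [← inv_pow]
  gcongr
  exact rpow_neg_le_inv hn.1.one_le hs

lemma logFactor_nonneg {s : ℝ} (hs : 1 ≤ s) (n : ℕ) : 0 ≤ logFactor s n := by
  unfold logFactor
  split_ifs with h
  · have h1 := rpow_neg_le_half h.1.two_le hs
    have h2 : 0 ≤ (n : ℝ) ^ (-s) := by positivity
    rw [sub_nonneg]
    exact Real.log_le_log (by linarith) (by linarith)
  · rfl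

lemma logFactor_le {s : ℝ} (hs : 1 ≤ s) (n : ℕ) : logFactor s n ≤ 4 * (n : ℝ) ^ (-s) := by
  by_cases h : n.Prime ∧ n % 4 = 1
  · have h1 := rpow_neg_le_half h.1.two_le hs
    have h2 : 0 ≤ (n : ℝ) ^ (-s) := by positivity
    rw [logFactor, if_pos h]
    have := (abs_le.1 (abs_log_one_add_sub_log_one_sub_sub_le h2 h1)).2
    nlinarith
  · rw [logFactor, if_neg h]; positivity

open ArithmeticFunction in
lemma summable_logFactor_one_sub :
    Summable fun n : ℕ => logFactor 1 n - (1 + chiFour n) * vonMangoldt n / n / Real.log n := by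
  have hs1 : Summable fun n : ℕ => 4 * ((n : ℝ) ^ 2)⁻¹ :=
    (Real.summable_nat_pow_inv.2 one_lt_two).mul_left 4
  have hs2 := (vonMangoldt.summable_residueClass_non_primes_div (0 : ZMod 1)).mul_left 2
  refine (hs1.add hs2).of_norm_bounded fun n => ?_
  have hres : vonMangoldt.residueClass (0 : ZMod 1) n = vonMangoldt n := by
    rw [vonMangoldt.residueClass, Set.indicator_of_mem]
    exact Subsingleton.elim _ _
  rw [hres, Real.norm_eq_abs]
  by_cases hp : n.Prime
  · have hlog : Real.log n ≠ 0 := (Real.log_pos (by exact_mod_cast hp.one_lt)).ne'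
    have hb : (1 + chiFour n) * vonMangoldt n / n / Real.log n = (1 + chiFour n) / n := by
      rw [vonMangoldt_apply_prime hp]; field_simp
    rw [hb, if_pos hp, zero_div, mul_zero, add_zero]
    by_cases h1 : n % 4 = 1
    · have := abs_logFactor_sub_le ⟨hp, h1⟩ le_rfl
      rwa [Real.rpow_neg_one, show (2 : ℝ) * (n : ℝ)⁻¹ = (1 + chiFour n) / n by
        rw [chiFour_eq, if_neg (by omega), if_pos h1]; ring] at this
    · rw [logFactor, if_neg (by tauto)]
      rcases hp.eq_two_or_odd with rfl | hodd
      · norm_num [chiFour_eq]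
      · rw [chiFour_eq, if_neg (by omega), if_neg h1]
        norm_num
  · rw [logFactor, if_neg (by tauto), if_neg hp, zero_sub, abs_neg]
    have hnn : 0 ≤ (1 + chiFour n) := by linarith [(abs_le.1 (abs_chiFour_le_one n)).1]
    have hle : (1 + chiFour n) ≤ 2 := by linarith [(abs_le.1 (abs_chiFour_le_one n)).2]
    have hL := vonMangoldt_nonneg (n := n)
    have hlog0 := Real.log_natCast_nonneg n
    rw [abs_of_nonneg (by positivity)]
    have hrhs : 2 * (vonMangoldt n / n) ≤ 4 * ((n : ℝ) ^ 2)⁻¹ + 2 * (vonMangoldt n / n) := by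
      have : 0 ≤ 4 * ((n : ℝ) ^ 2)⁻¹ := by positivity
      linarith
    refine le_trans ?_ hrhs
    rcases Nat.lt_or_ge n 4 with h4 | h4
    · have : n = 0 ∨ n = 1 := by
        interval_cases n <;> first | exact absurd (by decide) hp | simp
      rcases this with rfl | rfl <;> simp
    · have hlog1 : 1 ≤ Real.log n := by
        rw [Real.le_log_iff_exp_le (by positivity)]
        have : (4 : ℝ) ≤ n := by exact_mod_cast h4
        linarith [Real.exp_one_lt_d9]
      refine (div_le_self (by positivity) hlog1).trans ?_
      rw [mul_div_assoc]
      gcongr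

lemma exists_tendsto_sum_inv_mul_log_sub_log_log :
    ∃ l, Tendsto (fun N : ℕ => ∑ i ∈ range N, 1 / (((i + 2 : ℕ) : ℝ) * Real.log (i + 2 : ℕ)) -
      Real.log (Real.log (N + 2 : ℕ))) atTop (𝓝 l) := by
  set g : ℕ → ℝ := fun i => 1 / (((i + 2 : ℕ) : ℝ) * Real.log (i + 2 : ℕ)) with hg
  set u : ℕ → ℝ := fun N => ∑ i ∈ range N, g i - Real.log (Real.log (N + 2 : ℕ)) with hu
  have hL (N : ℕ) : 0 < Real.log (N + 2 : ℕ) :=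
    Real.log_pos (by exact_mod_cast (by omega : 1 < N + 2))
  have hlogdiv (N : ℕ) : Real.log (N + 1 + 2 : ℕ) - Real.log (N + 2 : ℕ) =
      Real.log (((N + 1 + 2 : ℕ) : ℝ) / (N + 2 : ℕ)) :=
    (Real.log_div (by positivity) (by positivity)).symm
  have hloglogdiv (N : ℕ) : Real.log (Real.log (N + 1 + 2 : ℕ)) - Real.log (Real.log (N + 2 : ℕ)) =
      Real.log (Real.log (N + 1 + 2 : ℕ) / Real.log (N + 2 : ℕ)) :=
    (Real.log_div (hL _).ne' (hL _).ne').symm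
  have hstep (N : ℕ) : u (N + 1) - u N = g N -
      (Real.log (Real.log (N + 1 + 2 : ℕ)) - Real.log (Real.log (N + 2 : ℕ))) := by
    simp only [hu]; rw [sum_range_succ]; ring
  have hup (N : ℕ) : Real.log (Real.log (N + 1 + 2 : ℕ)) - Real.log (Real.log (N + 2 : ℕ)) ≤ g N := by
    rw [hloglogdiv]
    refine (Real.log_le_sub_one_of_pos (div_pos (hL (N + 1)) (hL N))).trans ?_
    have h1 : Real.log (N + 1 + 2 : ℕ) - Real.log (N + 2 : ℕ) ≤ 1 / ((N + 2 : ℕ) : ℝ) := by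
      rw [hlogdiv]
      refine (Real.log_le_sub_one_of_pos (by positivity)).trans (le_of_eq ?_)
      push_cast; field_simp; ring
    rw [show ∀ a b : ℝ, 0 < b → a / b - 1 = (a - b) / b by intro a b hb; field_simp]
    · simp only [hg]
      rw [← div_div]
      exact div_le_div_of_nonneg_right h1 (hL N).le
    · exact hL N
  have hlow (N : ℕ) : g (N + 1) ≤
      Real.log (Real.log (N + 1 + 2 : ℕ)) - Real.log (Real.log (N + 2 : ℕ)) := by
    rw [hloglogdiv]
    refine le_trans ?_ (Real.one_sub_inv_le_log_of_pos (div_pos (hL (N + 1)) (hL N)))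
    have h1 : 1 / ((N + 1 + 2 : ℕ) : ℝ) ≤ Real.log (N + 1 + 2 : ℕ) - Real.log (N + 2 : ℕ) := by
      rw [hlogdiv]
      refine le_trans (le_of_eq ?_) (Real.one_sub_inv_le_log_of_pos (by positivity))
      push_cast; field_simp; ring
    rw [inv_div, show ∀ a b : ℝ, 0 < b → 1 - a / b = (b - a) / b by intro a b hb; field_simp]
    · simp only [hg]
      rw [← div_div]
      exact div_le_div_of_nonneg_right h1 (hL (N + 1)).le
    · exact hL (N + 1)
  have hmono : Monotone u := monotone_nat_of_le_succ fun N => by linarith [hstep N, hup N]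
  have hanti : Antitone fun N => u N + g N :=
    antitone_nat_of_succ_le fun N => by linarith [hstep N, hlow N]
  have hg0 (N : ℕ) : 0 ≤ g N := by
    have := hL N
    simp only [hg]; positivity
  refine ⟨_, tendsto_atTop_ciSup hmono ⟨u 0 + g 0, ?_⟩⟩
  rintro _ ⟨N, rfl⟩
  have := hanti (Nat.zero_le N)
  linarith [hg0 N]

open ArithmeticFunction in
/-- Mertens' second theorem for the primes `p ≡ 1 (mod 4)`, with an unspecified constant. -/
lemma exists_tendsto_sum_logFactor_sub_log_log :
    ∃ M, Tendsto (fun N : ℕ => ∑ n ∈ range (N + 1), logFactor 1 n -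
      Real.log (Real.log (N + 1 : ℕ))) atTop (𝓝 M) := by
  obtain ⟨C, hC⟩ := exists_abs_sum_one_add_chiFour_mul_vonMangoldt_le
  obtain ⟨l₁, hl₁⟩ := exists_tendsto_sum_inv_mul_log_sub_log_log
  set z : ℕ → ℝ := fun n => ((1 + chiFour n) * vonMangoldt n - 1) / n with hz
  have hcauchy := Antitone.cauchySeq_series_mul_of_tendsto_zero_of_bounded
    (b := C + |∑ i ∈ range 2, z i|) (f := fun i : ℕ => (Real.log (i + 2 : ℕ))⁻¹)
    (z := fun i => z (i + 2)) ?_ ?_ ?_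
  · obtain ⟨l₂, hl₂⟩ := cauchySeq_tendsto_of_complete hcauchy
    have hl₃ := ((summable_nat_add_iff 2).2 summable_logFactor_one_sub).hasSum.tendsto_sum_nat
    have hl := (hl₁.add (hl₂.add hl₃)).add_const (∑ i ∈ range 2, logFactor 1 i)
    refine ⟨_, (tendsto_add_atTop_iff_nat 1).1 (hl.congr fun N => ?_)⟩
    rw [show N + 1 + 1 = 2 + N by ring, sum_range_add, ← sum_add_distrib, add_comm 2 N,
      sub_add_eq_add_sub, ← sum_add_distrib, sub_add_eq_add_sub, add_comm]
    congr 2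
    refine sum_congr rfl fun i _ => ?_
    rw [add_comm 2 i, smul_eq_mul]
    simp only [hz]
    ring
  · intro a b hab
    have : (0 : ℝ) < Real.log (a + 2 : ℕ) :=
      Real.log_pos (by exact_mod_cast (by omega : 1 < a + 2))
    simp only
    gcongr
  · exact (Real.tendsto_log_atTop.comp (tendsto_natCast_atTop_atTop.comp
      (tendsto_add_atTop_nat 2))).inv_tendsto_atTop
  · intro n
    have h := sum_range_add z 2 n
    simp only [add_comm 2] at h
    rw [show ∑ i ∈ range n, z (i + 2) = ∑ i ∈ range (n + 1 + 1), z i -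
      ∑ i ∈ range 2, z i by rw [show n + 1 + 1 = n + 2 by ring, h]; ring]
    exact (norm_sub_le _ _).trans (add_le_add (hC (n + 1)) le_rfl)

open MeasureTheory in
/-- The Laplace transform of a step function with jumps `w n` at the points `c n`. -/
lemma integral_step_mul_exp {w c : ℕ → ℝ} (hc : ∀ n, 0 ≤ c n) {δ : ℝ} (hδ : 0 < δ)
    (hs : Summable fun n => |w n| * Real.exp (-δ * c n)) :
    IntegrableOn (fun t => (∑' n, if c n ≤ t then w n else 0) * (δ * Real.exp (-δ * t)))
      (Set.Ici 0) ∧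
    ∫ t in Set.Ici 0, (∑' n, if c n ≤ t then w n else 0) * (δ * Real.exp (-δ * t)) =
      ∑' n, w n * Real.exp (-δ * c n) := by
  set F : ℕ → ℝ → ℝ := fun n t => (if c n ≤ t then w n else 0) * (δ * Real.exp (-δ * t)) with hF
  have hFind (n : ℕ) :
      F n = (Set.Ici (c n)).indicator fun t => w n * (δ * Real.exp (-δ * t)) := by
    ext t
    by_cases h : c n ≤ t <;> simp [hF, Set.indicator, h]
  have hinter (n : ℕ) : Set.Ici (0 : ℝ) ∩ Set.Ici (c n) = Set.Ici (c n) :=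
    Set.inter_eq_right.2 (Set.Ici_subset_Ici.2 (hc n))
  have hexp (a : ℝ) : IntegrableOn (fun t => Real.exp (-δ * t)) (Set.Ici a) :=
    (integrableOn_Ici_iff_integrableOn_Ioi (by simp)).2 (integrableOn_exp_mul_Ioi (by linarith) a)
  have hval (a : ℝ) : ∫ t in Set.Ici a, δ * Real.exp (-δ * t) = Real.exp (-δ * a) := by
    rw [integral_Ici_eq_integral_Ioi, integral_const_mul, integral_exp_mul_Ioi (by linarith)]
    field_simp
  have hint (n : ℕ) : Integrable (F n) (volume.restrict (Set.Ici 0)) := by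
    rw [hFind, integrable_indicator_iff measurableSet_Ici, IntegrableOn,
      Measure.restrict_restrict measurableSet_Ici, Set.inter_comm, hinter]
    exact ((hexp _).const_mul _).const_mul _
  have hFval (n : ℕ) : ∫ t in Set.Ici 0, F n t = w n * Real.exp (-δ * c n) := by
    rw [hFind, setIntegral_indicator measurableSet_Ici, hinter, integral_const_mul, hval]
  have hFnorm (n : ℕ) : ∫ t in Set.Ici 0, ‖F n t‖ = |w n| * Real.exp (-δ * c n) := by
    have : (fun t => ‖F n t‖) =
        (Set.Ici (c n)).indicator fun t => |w n| * (δ * Real.exp (-δ * t)) := by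
      ext t
      by_cases h : c n ≤ t <;> simp [hF, Set.indicator, h, abs_of_pos hδ]
    rw [this, setIntegral_indicator measurableSet_Ici, hinter, integral_const_mul, hval]
  have hsum : Summable fun n => ∫ t in Set.Ici 0, ‖F n t‖ := by simpa only [hFnorm] using hs
  simp_rw [← tsum_mul_right]
  refine ⟨?_, ?_⟩
  · have hpt (t : ℝ) : Summable fun n => F n t := by
      refine (hs.mul_right (δ * Real.exp (-δ * t) * Real.exp (δ * t))).of_norm_bounded fun n => ?_
      by_cases h : c n ≤ t
      · have h1 : 1 ≤ Real.exp (-δ * c n) * Real.exp (δ * t) := by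
          rw [← Real.exp_add, Real.one_le_exp_iff]
          nlinarith
        simp only [hF, h, if_true, norm_mul, Real.norm_eq_abs, Real.abs_exp, abs_of_pos hδ]
        calc |w n| * (δ * Real.exp (-δ * t))
            ≤ |w n| * (δ * Real.exp (-δ * t)) * (Real.exp (-δ * c n) * Real.exp (δ * t)) :=
              le_mul_of_one_le_right (by positivity) h1
          _ = _ := by ring
      · simp only [hF, h, if_false, zero_mul, norm_zero]
        positivity
    refine ⟨aestronglyMeasurable_of_tendsto_ae atTop
      (fun N : ℕ => Finset.aestronglyMeasurable_fun_sum (range N) fun n _ => (hint n).1)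
      (Eventually.of_forall fun t => (hpt t).hasSum.tendsto_sum_nat), ?_⟩
    calc ∫⁻ t in Set.Ici 0, ‖∑' n, F n t‖ₑ ≤ ∫⁻ t in Set.Ici 0, ∑' n, ‖F n t‖ₑ :=
          lintegral_mono fun t => enorm_tsum_le_tsum_enorm
      _ = ∑' n, ∫⁻ t in Set.Ici 0, ‖F n t‖ₑ := lintegral_tsum fun n => (hint n).1.enorm
      _ = ∑' n, ENNReal.ofReal (∫ t in Set.Ici 0, ‖F n t‖) := by
          simp_rw [ofReal_integral_norm_eq_lintegral_enorm (hint _)]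
      _ < ⊤ := by
          rw [← ENNReal.ofReal_tsum_of_nonneg (fun n => by positivity) hsum]
          exact ENNReal.ofReal_lt_top
  · have := (hasSum_integral_of_summable_integral_norm hint hsum).tsum_eq
    simp only [hFval] at this
    exact this.symm

open MeasureTheory in
/-- A function tending to `M` at infinity has exponential means tending to `M`. -/
lemma tendsto_integral_mul_exp {ε : ℝ → ℝ} {M : ℝ}
    (hint : ∀ δ : ℝ, 0 < δ → IntegrableOn (fun t => ε t * (δ * Real.exp (-δ * t))) (Set.Ici 0))
    (h : Tendsto ε atTop (𝓝 M)) :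
    Tendsto (fun δ : ℝ => ∫ t in Set.Ici 0, ε t * (δ * Real.exp (-δ * t))) (𝓝[>] 0) (𝓝 M) := by
  have hexp {δ : ℝ} (hδ : 0 < δ) : IntegrableOn (fun t => δ * Real.exp (-δ * t)) (Set.Ici 0) :=
    ((integrableOn_Ici_iff_integrableOn_Ioi (by simp)).2
      (integrableOn_exp_mul_Ioi (by linarith) 0)).const_mul δ
  have hval {δ : ℝ} (hδ : 0 < δ) : ∫ t in Set.Ici 0, δ * Real.exp (-δ * t) = 1 := by
    rw [integral_Ici_eq_integral_Ioi, integral_const_mul, integral_exp_mul_Ioi (by linarith)]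
    simp; field_simp
  have hint' {δ : ℝ} (hδ : 0 < δ) :
      IntegrableOn (fun t => (ε t - M) * (δ * Real.exp (-δ * t))) (Set.Ici 0) := by
    simp_rw [sub_mul]
    exact (hint δ hδ).sub ((hexp hδ).const_mul M)
  rw [Metric.tendsto_nhds]
  intro η hη
  obtain ⟨T, hT⟩ := eventually_atTop.1 (Metric.tendsto_nhds.1 h (η / 2) (by positivity))
  set g : ℝ → ℝ := fun t => |ε t - M| * Real.exp (-t) with hg
  have hgint : IntegrableOn g (Set.Ici 0) := by
    refine (hint' one_pos).norm.congr (Eventually.of_forall fun t => ?_)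
    simp [hg]
  set K := Real.exp T * ∫ t in Set.Ici 0, g t with hK
  have hsmall : ∀ᶠ δ : ℝ in 𝓝[>] 0, δ * K < η / 2 := by
    have : Tendsto (fun δ : ℝ => δ * K) (𝓝[>] 0) (𝓝 (0 * K)) :=
      (tendsto_id.mono_left nhdsWithin_le_nhds).mul_const K
    rw [zero_mul] at this
    exact this.eventually_lt_const (by positivity)
  filter_upwards [hsmall, self_mem_nhdsWithin] with δ hδK hδ
  replace hδ : 0 < δ := hδ
  have hdist : (∫ t in Set.Ici 0, ε t * (δ * Real.exp (-δ * t))) - M =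
      ∫ t in Set.Ici 0, (ε t - M) * (δ * Real.exp (-δ * t)) := by
    simp_rw [sub_mul]
    rw [integral_sub (hint δ hδ) ((hexp hδ).const_mul M), integral_const_mul, hval hδ, mul_one]
  rw [Real.dist_eq, hdist]
  calc |∫ t in Set.Ici 0, (ε t - M) * (δ * Real.exp (-δ * t))|
      ≤ ∫ t in Set.Ici 0, ‖(ε t - M) * (δ * Real.exp (-δ * t))‖ := by
        rw [← Real.norm_eq_abs]
        exact norm_integral_le_integral_norm _
    _ ≤ ∫ t in Set.Ici 0, (η / 2 * (δ * Real.exp (-δ * t)) + δ * Real.exp T * g t) := by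
        refine setIntegral_mono_on (hint' hδ).norm
          (((hexp hδ).const_mul _).add (hgint.const_mul _)) measurableSet_Ici fun t ht => ?_
        have ht0 : 0 ≤ t := ht
        have hg0 : 0 ≤ g t := by simp only [hg]; positivity
        have hE : 0 < δ * Real.exp (-δ * t) := by positivity
        rw [norm_mul, Real.norm_eq_abs, Real.norm_of_nonneg hE.le]
        rcases le_or_gt T t with h1 | h1
        · have := (hT t h1).le
          rw [Real.dist_eq] at this
          have h2 := mul_le_mul_of_nonneg_right this hE.le
          have : 0 ≤ δ * Real.exp T * g t := by positivity
          linarith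
        · have h2 : Real.exp (-δ * t) ≤ Real.exp T * Real.exp (-t) := by
            rw [← Real.exp_add, Real.exp_le_exp]
            nlinarith
          have h3 : |ε t - M| * (δ * Real.exp (-δ * t)) ≤ δ * Real.exp T * g t := by
            calc _ ≤ |ε t - M| * (δ * (Real.exp T * Real.exp (-t))) := by gcongr
              _ = _ := by simp only [hg]; ring
          have : 0 ≤ η / 2 * (δ * Real.exp (-δ * t)) := by positivity
          linarith
    _ = η / 2 + δ * K := by
        rw [integral_add ((hexp hδ).const_mul _) (hgint.const_mul _), integral_const_mul,
          hval hδ, integral_const_mul, hK]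
        ring
    _ < η := by linarith

/-- An Abelian theorem comparing two generalized Dirichlet series at the origin. -/
lemma tendsto_tsum_mul_exp_sub {w c w' c' : ℕ → ℝ} {M : ℝ} (hc : ∀ n, 0 ≤ c n)
    (hs : ∀ δ : ℝ, 0 < δ → Summable fun n => |w n| * Real.exp (-δ * c n))
    (hc' : ∀ n, 0 ≤ c' n) (hs' : ∀ δ : ℝ, 0 < δ → Summable fun n => |w' n| * Real.exp (-δ * c' n))
    (h : Tendsto (fun t => (∑' n, if c n ≤ t then w n else 0) -
      ∑' n, if c' n ≤ t then w' n else 0) atTop (𝓝 M)) :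
    Tendsto (fun δ : ℝ => ∑' n, w n * Real.exp (-δ * c n) - ∑' n, w' n * Real.exp (-δ * c' n))
      (𝓝[>] 0) (𝓝 M) := by
  refine (tendsto_integral_mul_exp (fun δ hδ => ?_) h).congr' ?_
  · simp_rw [sub_mul]
    exact (integral_step_mul_exp hc hδ (hs δ hδ)).1.sub (integral_step_mul_exp hc' hδ (hs' δ hδ)).1
  · filter_upwards [self_mem_nhdsWithin] with δ hδ
    obtain ⟨h1, h2⟩ := integral_step_mul_exp hc hδ (hs δ hδ)
    obtain ⟨h3, h4⟩ := integral_step_mul_exp hc' hδ (hs' δ hδ)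
    simp_rw [sub_mul]
    rw [MeasureTheory.integral_sub h1 h3, h2, h4]

lemma tsum_ite_log_le {w : ℕ → ℝ} (hw : w 0 = 0) (t : ℝ) :
    (∑' n : ℕ, if Real.log n ≤ t then w n else 0) =
      ∑ n ∈ range (⌊Real.exp t⌋₊ + 1), w n := by
  have key {n : ℕ} (hn : n ≠ 0) : Real.log n ≤ t ↔ n ∈ range (⌊Real.exp t⌋₊ + 1) := by
    rw [mem_range, Nat.lt_succ_iff, Nat.le_floor_iff' hn,
      Real.log_le_iff_le_exp (by exact_mod_cast hn.bot_lt)]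
  rw [tsum_eq_sum (s := range (⌊Real.exp t⌋₊ + 1))]
  · refine sum_congr rfl fun n hn => ?_
    rcases eq_or_ne n 0 with rfl | h0
    · simp [hw]
    · rw [if_pos ((key h0).2 hn)]
  · intro n hn
    rcases eq_or_ne n 0 with rfl | h0
    · simp [hw]
    · rw [if_neg fun h => hn ((key h0).1 h)]

lemma tsum_ite_add_one_le (t : ℝ) :
    (∑' n : ℕ, if (n : ℝ) + 1 ≤ t then 1 / ((n : ℝ) + 1) else 0) = harmonic ⌊t⌋₊ := by
  have key (n : ℕ) : (n : ℝ) + 1 ≤ t ↔ n ∈ range ⌊t⌋₊ := by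
    rw [mem_range, ← Nat.succ_le_iff, Nat.le_floor_iff' (by simp), Nat.succ_eq_add_one]
    push_cast
    rfl
  simp_rw [key]
  rw [tsum_eq_sum (s := range ⌊t⌋₊) (fun n hn => if_neg hn), harmonic]
  push_cast
  exact sum_congr rfl fun n hn => by rw [if_pos hn, one_div]

lemma tendsto_log_floor_add_one_sub :
    Tendsto (fun x : ℝ => Real.log (⌊x⌋₊ + 1) - Real.log x) atTop (𝓝 0) := by
  refine squeeze_zero' ?_ ?_ tendsto_inv_atTop_zero
  · filter_upwards [eventually_gt_atTop 0] with x hx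
    exact sub_nonneg.2 (Real.log_le_log hx (Nat.lt_floor_add_one x).le)
  · filter_upwards [eventually_gt_atTop 0] with x hx
    rw [← Real.log_div (by positivity) hx.ne']
    refine (Real.log_le_sub_one_of_pos (by positivity)).trans ?_
    rw [div_sub_one hx.ne', inv_eq_one_div]
    gcongr
    linarith [Nat.floor_le hx.le]

lemma tendsto_log_log_floor_add_one_sub :
    Tendsto (fun x : ℝ => Real.log (Real.log (⌊x⌋₊ + 1)) - Real.log (Real.log x)) atTop
      (𝓝 0) := by
  have h1 : Tendsto (fun x : ℝ => (Real.log (⌊x⌋₊ + 1) - Real.log x) * (Real.log x)⁻¹ + 1) atTop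
      (𝓝 (0 * 0 + 1)) :=
    (tendsto_log_floor_add_one_sub.mul
      (tendsto_inv_atTop_zero.comp Real.tendsto_log_atTop)).add_const 1
  have h2 := (Real.continuousAt_log (by norm_num : (0 * 0 + 1 : ℝ) ≠ 0)).tendsto.comp h1
  simp only [zero_mul, zero_add, Real.log_one] at h2
  refine h2.congr' ?_
  filter_upwards [eventually_gt_atTop 1] with x hx
  have hl : 0 < Real.log x := Real.log_pos hx
  have hl' : 0 < Real.log (⌊x⌋₊ + 1) :=
    hl.trans_le (Real.log_le_log (by linarith) (Nat.lt_floor_add_one x).le)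
  rw [← Real.log_div hl'.ne' hl.ne', Function.comp_apply]
  congr 1
  field_simp
  ring

lemma rpow_neg_eq_exp_neg_mul_log {n : ℕ} (hn : n ≠ 0) (δ : ℝ) :
    (n : ℝ) ^ (-δ) = Real.exp (-δ * Real.log n) := by
  rw [Real.rpow_def_of_pos (by exact_mod_cast hn.bot_lt), mul_comm]

lemma rpow_neg_one_add {n : ℕ} (δ : ℝ) (hn : n ≠ 0) :
    (n : ℝ) ^ (-(1 + δ)) = (n : ℝ)⁻¹ * Real.exp (-δ * Real.log n) := by
  rw [← rpow_neg_eq_exp_neg_mul_log hn, neg_add, Real.rpow_add (by exact_mod_cast hn.bot_lt),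
    Real.rpow_neg_one]

lemma summable_rpow_neg_one_add {δ : ℝ} (hδ : 0 < δ) :
    Summable fun n : ℕ => (n : ℝ) ^ (-(1 + δ)) :=
  Real.summable_nat_rpow.2 (by linarith)

lemma logFactor_zero (s : ℝ) : logFactor s 0 = 0 := by simp [logFactor]

lemma summable_logFactor_one_mul_exp {δ : ℝ} (hδ : 0 < δ) :
    Summable fun n : ℕ => |logFactor 1 n| * Real.exp (-δ * Real.log n) := by
  refine ((summable_rpow_neg_one_add hδ).mul_left 4).of_nonneg_of_le (fun n => by positivity)
    fun n => ?_
  rcases eq_or_ne n 0 with rfl | hn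
  · rw [logFactor_zero, abs_zero, zero_mul]
    positivity
  · rw [rpow_neg_one_add δ hn, abs_of_nonneg (logFactor_nonneg le_rfl n), ← mul_assoc]
    gcongr
    simpa [Real.rpow_neg_one] using logFactor_le le_rfl n

lemma hasSum_one_div_mul_exp {δ : ℝ} (hδ : 0 < δ) :
    HasSum (fun n : ℕ => 1 / ((n : ℝ) + 1) * Real.exp (-δ * ((n : ℝ) + 1)))
      (-Real.log (1 - Real.exp (-δ))) := by
  have h1 : |Real.exp (-δ)| < 1 := by
    rw [abs_of_pos (Real.exp_pos _), Real.exp_lt_one_iff]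
    linarith
  refine (Real.hasSum_pow_div_log_of_abs_lt_one h1).congr_fun ?_
  intro n
  rw [← Real.exp_nat_mul]
  push_cast
  rw [show -δ * ((n : ℝ) + 1) = (n + 1) * -δ by ring]
  ring

lemma tendsto_tsum_logFactor_one_mul_exp {M : ℝ}
    (hM : Tendsto (fun N : ℕ => ∑ n ∈ range (N + 1), logFactor 1 n -
      Real.log (Real.log (N + 1 : ℕ))) atTop (𝓝 M)) :
    Tendsto (fun δ : ℝ => ∑' n : ℕ, logFactor 1 n * Real.exp (-δ * Real.log n) +
      Real.log (1 - Real.exp (-δ))) (𝓝[>] 0) (𝓝 (M - Real.eulerMascheroniConstant)) := by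
  have h := tendsto_tsum_mul_exp_sub (w := logFactor 1) (c := fun n => Real.log n)
    (w' := fun n => 1 / ((n : ℝ) + 1)) (c' := fun n => (n : ℝ) + 1)
    (M := M - Real.eulerMascheroniConstant)
    (fun n => Real.log_natCast_nonneg n) (fun δ hδ => summable_logFactor_one_mul_exp hδ)
    (fun n => by positivity)
    (fun δ hδ => (hasSum_one_div_mul_exp hδ).summable.congr fun n => by
      rw [abs_of_nonneg (by positivity)]) ?_
  · refine h.congr' ?_
    filter_upwards [self_mem_nhdsWithin] with δ hδ
    rw [(hasSum_one_div_mul_exp hδ).tsum_eq, sub_neg_eq_add]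
  · simp_rw [tsum_ite_log_le (logFactor_zero 1), tsum_ite_add_one_le]
    have hfloor := tendsto_nat_floor_atTop (α := ℝ)
    have h1 := hM.comp (hfloor.comp Real.tendsto_exp_atTop)
    have h2 := Real.tendsto_harmonic_sub_log_add_one.comp hfloor
    have h3 := tendsto_log_log_floor_add_one_sub.comp Real.tendsto_exp_atTop
    have h4 := ((h1.sub h2).add h3).sub tendsto_log_floor_add_one_sub
    rw [add_zero, sub_zero] at h4
    refine h4.congr fun t => ?_
    simp only [Function.comp_apply, Real.log_exp]
    push_cast
    ring

/-- Abel's limit theorem for `L(s, χ₄)` at `s = 1`. -/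
lemma tendsto_tsum_chiFour_mul_rpow :
    Tendsto (fun δ : ℝ => ∑' n : ℕ, chiFour n * (n : ℝ) ^ (-(1 + δ))) (𝓝[>] 0)
      (𝓝 (Real.pi / 4)) := by
  have h := tendsto_tsum_mul_exp_sub (w := fun n => chiFour n / n) (c := fun n => Real.log n)
    (w' := 0) (c' := 0) (M := Real.pi / 4)
    (fun n => Real.log_natCast_nonneg n) (fun δ hδ => ?_)
    (fun n => le_rfl) (fun δ hδ => by simp) ?_
  · refine h.congr fun δ => ?_
    simp only [Pi.zero_apply, zero_mul, tsum_zero, sub_zero]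
    refine tsum_congr fun n => ?_
    rcases eq_or_ne n 0 with rfl | hn
    · simp [chiFour_eq]
    · rw [rpow_neg_one_add δ hn]
      ring
  · refine (summable_rpow_neg_one_add hδ).of_nonneg_of_le (fun n => by positivity) fun n => ?_
    rcases eq_or_ne n 0 with rfl | hn
    · simp only [chiFour_eq]
      simp
      positivity
    · rw [rpow_neg_one_add δ hn]
      gcongr
      rw [abs_div, Nat.abs_cast, inv_eq_one_div]
      gcongr
      exact abs_chiFour_le_one n
  · simp only [Pi.zero_apply, ite_self, tsum_zero, sub_zero]
    simp_rw [tsum_ite_log_le (w := fun n : ℕ => chiFour n / n) (by simp)]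
    exact tendsto_sum_chiFour_div.comp (tendsto_nat_floor_atTop.comp Real.tendsto_exp_atTop)

lemma summable_logFactor {s : ℝ} (hs : 1 < s) : Summable (logFactor s) :=
  ((Real.summable_nat_rpow.2 (by linarith : -s < -1)).mul_left 4).of_nonneg_of_le
    (logFactor_nonneg hs.le) (logFactor_le hs.le)

lemma continuousAt_logFactor {s : ℝ} (hs : 1 ≤ s) (n : ℕ) :
    ContinuousAt (fun s => logFactor s n) s := by
  unfold logFactor
  by_cases h : n.Prime ∧ n % 4 = 1
  · simp only [h, and_self, if_true]
    have hn : (0 : ℝ) < n := by exact_mod_cast h.1.pos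
    have h0 : (n : ℝ) ^ (-s) ≤ 1 / 2 := rpow_neg_le_half h.1.two_le hs
    have h1 : (0 : ℝ) < (n : ℝ) ^ (-s) := by positivity
    have hc : ContinuousAt (fun s : ℝ => (n : ℝ) ^ (-s)) s :=
      (Real.continuousAt_const_rpow hn.ne').comp continuousAt_neg
    have h2 : (1 : ℝ) + (n : ℝ) ^ (-s) ≠ 0 := by positivity
    have h3 : (1 : ℝ) - (n : ℝ) ^ (-s) ≠ 0 := by linarith
    exact ((continuousAt_const.add hc).log h2).sub ((continuousAt_const.sub hc).log h3)
  · simp only [h, if_false]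
    exact continuousAt_const

lemma tendsto_tsum_logFactor_one_mul_exp_sub :
    Tendsto (fun δ : ℝ => ∑' n : ℕ,
      (logFactor 1 n * Real.exp (-δ * Real.log n) - logFactor (1 + δ) n)) (𝓝[>] 0) (𝓝 0) := by
  rw [show 𝓝 (0 : ℝ) = 𝓝 (∑' _ : ℕ, (0 : ℝ)) by simp]
  refine tendsto_tsum_of_dominated_convergence (bound := fun n : ℕ => 8 * ((n : ℝ) ^ 2)⁻¹)
    ((Real.summable_nat_pow_inv.2 one_lt_two).mul_left 8) (fun n => ?_) ?_
  · have h1 : ContinuousAt (fun δ : ℝ => logFactor (1 + δ) n) 0 :=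
      ContinuousAt.comp (g := fun s => logFactor s n)
        (continuousAt_logFactor (by norm_num) n) (by fun_prop)
    have h2 : ContinuousAt (fun δ : ℝ => logFactor 1 n * Real.exp (-δ * Real.log n) -
        logFactor (1 + δ) n) 0 := ContinuousAt.sub (by fun_prop) h1
    simpa using h2.tendsto.mono_left nhdsWithin_le_nhds
  · filter_upwards [self_mem_nhdsWithin] with δ hδ n
    replace hδ : 0 < δ := hδ
    by_cases h : n.Prime ∧ n % 4 = 1
    · have h1 := abs_logFactor_sub_le h le_rfl
      have h2 := abs_logFactor_sub_le h (by linarith : 1 ≤ 1 + δ)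
      rw [Real.rpow_neg_one] at h1
      rw [rpow_neg_one_add δ h.1.ne_zero] at h2
      set E := Real.exp (-δ * Real.log n) with hE
      have hE0 : 0 < E := Real.exp_pos _
      have hE1 : E ≤ 1 := by
        rw [hE, Real.exp_le_one_iff]
        nlinarith [Real.log_natCast_nonneg n]
      have h3 : |(logFactor 1 n - 2 * (n : ℝ)⁻¹) * E| ≤ 4 * ((n : ℝ) ^ 2)⁻¹ := by
        rw [abs_mul, abs_of_pos hE0]
        exact (mul_le_of_le_one_right (abs_nonneg _) hE1).trans h1
      rw [Real.norm_eq_abs]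
      rw [abs_le] at h2 h3 ⊢
      constructor <;> linarith [h2.1, h2.2, h3.1, h3.2]
    · simp only [logFactor, h, if_false]
      simp

/-- The Euler product of a completely multiplicative function with absolutely convergent sum. -/
lemma tendsto_prod_primesBelow_one_sub_inv {f : ℕ → ℝ} (h0 : f 0 = 0) (h1 : f 1 = 1)
    (hmul : ∀ m n, f (m * n) = f m * f n) (hs : Summable fun n => ‖f n‖) :
    Tendsto (fun N : ℕ => ∏ p ∈ N.primesBelow, (1 - f p)⁻¹) atTop (𝓝 (∑' n, f n)) :=
  EulerProduct.eulerProduct_completely_multiplicative (f := ⟨⟨f, h0⟩, h1, hmul⟩) hs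

lemma exp_logFactor {n : ℕ} (hn : n.Prime ∧ n % 4 = 1) {s : ℝ} (hs : 1 ≤ s) :
    Real.exp (logFactor s n) = (1 + (n : ℝ) ^ (-s)) / (1 - (n : ℝ) ^ (-s)) := by
  have h0 : (n : ℝ) ^ (-s) ≤ 1 / 2 := rpow_neg_le_half hn.1.two_le hs
  rw [logFactor, if_pos hn, Real.exp_sub, Real.exp_log (by positivity),
    Real.exp_log (by linarith)]

lemma sum_primesBelow_logFactor (s : ℝ) (N : ℕ) :
    ∑ p ∈ N.primesBelow, logFactor s p = ∑ n ∈ range N, logFactor s n := by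
  refine sum_subset (filter_subset _ _) fun n hn hp => ?_
  rw [logFactor, if_neg fun h => hp (Nat.mem_primesBelow.2 ⟨mem_range.1 hn, h.1⟩)]

lemma local_factor_eq {p : ℕ} (hp : p.Prime) {s : ℝ} (hs : 1 ≤ s) :
    (1 - (p : ℝ) ^ (-s))⁻¹ * (1 - chiFour p * (p : ℝ) ^ (-s))⁻¹ =
      Real.exp (logFactor s p) * (if p = 2 then 1 + (2 : ℝ) ^ (-s) else 1) *
        (1 - (p : ℝ) ^ (-(2 * s)))⁻¹ := by
  have h0 : (p : ℝ) ^ (-s) ≤ 1 / 2 := rpow_neg_le_half hp.two_le hs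
  have hpos : (0 : ℝ) < (p : ℝ) ^ (-s) := Real.rpow_pos_of_pos (by exact_mod_cast hp.pos) _
  have hsq : (p : ℝ) ^ (-(2 * s)) = ((p : ℝ) ^ (-s)) ^ 2 := by
    rw [← Real.rpow_natCast, ← Real.rpow_mul (by positivity)]
    congr 1
    push_cast
    ring
  have h1 : (1 : ℝ) - (p : ℝ) ^ (-s) ≠ 0 := by linarith
  have h2 : (1 : ℝ) + (p : ℝ) ^ (-s) ≠ 0 := by positivity
  rw [hsq, show
      (1 : ℝ) - ((p : ℝ) ^ (-s)) ^ 2 = (1 - (p : ℝ) ^ (-s)) * (1 + (p : ℝ) ^ (-s)) by ring,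
    chiFour_eq]
  rcases hp.eq_two_or_odd with rfl | hodd
  · simp only [logFactor]
    norm_num at h1 h2 ⊢
    field_simp
  · have h3 : p ≠ 2 := by omega
    rw [if_neg (by omega), if_neg h3]
    by_cases h4 : p % 4 = 1
    · rw [if_pos h4, exp_logFactor ⟨hp, h4⟩ hs, one_mul]
      field_simp
    · rw [if_neg h4, logFactor, if_neg (fun h => h4 h.2), Real.exp_zero]
      rw [show (1 : ℝ) - -1 * (p : ℝ) ^ (-s) = 1 + (p : ℝ) ^ (-s) by ring]
      field_simp

lemma natCast_mul_rpow (m n : ℕ) (s : ℝ) :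
    ((m * n : ℕ) : ℝ) ^ s = (m : ℝ) ^ s * (n : ℝ) ^ s := by
  rw [Nat.cast_mul, Real.mul_rpow (by positivity) (by positivity)]

/-- The factorization of the Euler product over primes `p ≡ 1 (mod 4)`. -/
lemma tsum_rpow_mul_tsum_chiFour_mul_rpow {s : ℝ} (hs : 1 < s) :
    (∑' n : ℕ, (n : ℝ) ^ (-s)) * ∑' n : ℕ, chiFour n * (n : ℝ) ^ (-s) =
      Real.exp (∑' n, logFactor s n) * (1 + (2 : ℝ) ^ (-s)) * ∑' n : ℕ, (n : ℝ) ^ (-(2 * s)) := by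
  have hsum {r : ℝ} (hr : 1 < r) : Summable fun n : ℕ => ‖(n : ℝ) ^ (-r)‖ :=
    (Real.summable_nat_rpow.2 (by linarith : -r < -1)).norm
  have hzero {r : ℝ} (hr : 1 < r) : ((0 : ℕ) : ℝ) ^ (-r) = 0 := by
    rw [Nat.cast_zero, Real.zero_rpow (by linarith)]
  have h1 := tendsto_prod_primesBelow_one_sub_inv (f := fun n : ℕ => (n : ℝ) ^ (-s)) (hzero hs)
    (by simp) (fun m n => natCast_mul_rpow m n _) (hsum hs)
  have h2 := tendsto_prod_primesBelow_one_sub_inv (f := fun n : ℕ => chiFour n * (n : ℝ) ^ (-s))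
    (by rw [hzero hs, mul_zero]) (by simp [chiFour_eq])
    (fun m n => by rw [natCast_mul_rpow, chiFour_mul]; ring)
    ((hsum hs).of_nonneg_of_le (fun n => norm_nonneg _) fun n => by
      rw [norm_mul]
      exact mul_le_of_le_one_left (norm_nonneg _) (abs_chiFour_le_one n))
  have hs2 : 1 < 2 * s := by linarith
  have h3 := tendsto_prod_primesBelow_one_sub_inv (f := fun n : ℕ => (n : ℝ) ^ (-(2 * s)))
    (hzero hs2) (by simp) (fun m n => natCast_mul_rpow m n _) (hsum hs2)
  have h4 : Tendsto (fun N : ℕ => Real.exp (∑ n ∈ range N, logFactor s n)) atTop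
      (𝓝 (Real.exp (∑' n, logFactor s n))) :=
    (Real.continuous_exp.tendsto _).comp (summable_logFactor hs).hasSum.tendsto_sum_nat
  refine tendsto_nhds_unique (h1.mul h2) (((h4.mul_const _).mul h3).congr' ?_)
  filter_upwards [eventually_ge_atTop 3] with N hN
  rw [← prod_mul_distrib, prod_congr rfl fun p hp =>
    local_factor_eq (Nat.prime_of_mem_primesBelow hp) hs.le, prod_mul_distrib, prod_mul_distrib,
    ← Real.exp_sum, sum_primesBelow_logFactor, prod_ite_eq',
    if_pos (Nat.mem_primesBelow.2 ⟨by omega, Nat.prime_two⟩)]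

lemma tendsto_tsum_rpow_neg_two_mul_one_add :
    Tendsto (fun δ : ℝ => ∑' n : ℕ, (n : ℝ) ^ (-(2 * (1 + δ)))) (𝓝[>] 0)
      (𝓝 (Real.pi ^ 2 / 6)) := by
  rw [← hasSum_zeta_two.tsum_eq]
  refine tendsto_tsum_of_dominated_convergence hasSum_zeta_two.summable (fun n => ?_) ?_
  · rcases eq_or_ne n 0 with rfl | hn
    · refine tendsto_const_nhds.congr' ?_
      filter_upwards [self_mem_nhdsWithin] with δ hδ
      replace hδ : 0 < δ := hδ
      rw [Nat.cast_zero, Real.zero_rpow (by linarith)]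
      simp
    · have hc : Continuous fun δ : ℝ => (n : ℝ) ^ (-(2 * (1 + δ))) :=
        continuous_const.rpow (by fun_prop) fun _ => Or.inl (by exact_mod_cast hn)
      have := (hc.tendsto 0).mono_left (nhdsWithin_le_nhds (s := Set.Ioi 0))
      convert this using 2
      rw [add_zero, mul_one, Real.rpow_neg (by positivity), one_div]
      norm_cast
  · filter_upwards [self_mem_nhdsWithin] with δ hδ n
    replace hδ : 0 < δ := hδ
    rcases eq_or_ne n 0 with rfl | hn
    · rw [Nat.cast_zero, Real.zero_rpow (by linarith)]
      simp
    · rw [Real.norm_of_nonneg (by positivity), one_div, ← Real.rpow_two,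
        ← Real.rpow_neg (by positivity)]
      exact Real.rpow_le_rpow_of_exponent_le (by exact_mod_cast hn.bot_lt) (by linarith)

lemma tendsto_mul_exp_tsum_logFactor :
    Tendsto (fun δ : ℝ => δ * Real.exp (∑' n, logFactor (1 + δ) n)) (𝓝[>] 0)
      (𝓝 (1 / Real.pi)) := by
  have h1 : Tendsto (fun δ : ℝ => δ * ∑' n : ℕ, (n : ℝ) ^ (-(1 + δ))) (𝓝[>] 0) (𝓝 1) := by
    have hshift : Tendsto (fun δ : ℝ => 1 + δ) (𝓝[>] 0) (𝓝[>] 1) := by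
      refine tendsto_nhdsWithin_iff.2 ⟨?_, ?_⟩
      · have : Continuous fun δ : ℝ => 1 + δ := by fun_prop
        simpa using (this.tendsto 0).mono_left nhdsWithin_le_nhds
      · filter_upwards [self_mem_nhdsWithin] with δ hδ
        simpa using hδ
    refine (tendsto_sub_mul_tsum_nat_rpow.comp hshift).congr fun δ => ?_
    simp only [Function.comp_apply, add_sub_cancel_left]
    simp_rw [Real.rpow_neg (Nat.cast_nonneg _), one_div]
  have h2 : Tendsto (fun δ : ℝ => 1 + (2 : ℝ) ^ (-(1 + δ))) (𝓝[>] 0) (𝓝 (3 / 2)) := by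
    have hc : Continuous fun δ : ℝ => 1 + (2 : ℝ) ^ (-(1 + δ)) :=
      continuous_const.add (continuous_const.rpow (by fun_prop) fun _ => Or.inl (by norm_num))
    have := (hc.tendsto 0).mono_left (nhdsWithin_le_nhds (s := Set.Ioi 0))
    convert this using 2
    rw [add_zero, Real.rpow_neg_one]
    norm_num
  have hpi := Real.pi_pos
  have h3 := (h1.mul tendsto_tsum_chiFour_mul_rpow).div
    (h2.mul tendsto_tsum_rpow_neg_two_mul_one_add) (by positivity)
  rw [show 1 * (Real.pi / 4) / (3 / 2 * (Real.pi ^ 2 / 6)) = 1 / Real.pi by field_simp; norm_num]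
    at h3
  refine h3.congr' ?_
  have hne : ∀ᶠ δ : ℝ in 𝓝[>] 0, ∑' n : ℕ, (n : ℝ) ^ (-(2 * (1 + δ))) ≠ 0 :=
    tendsto_tsum_rpow_neg_two_mul_one_add.eventually_ne (by positivity)
  filter_upwards [self_mem_nhdsWithin, hne] with δ hδ hne
  replace hδ : 0 < δ := hδ
  have h4 := tsum_rpow_mul_tsum_chiFour_mul_rpow (by linarith : 1 < 1 + δ)
  have h5 : (0 : ℝ) < 1 + (2 : ℝ) ^ (-(1 + δ)) := by positivity
  rw [Pi.div_apply, mul_assoc, h4, mul_assoc (Real.exp _), ← mul_assoc δ,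
    mul_div_cancel_right₀ _ (mul_ne_zero h5.ne' hne)]

lemma tendsto_one_sub_exp_neg_div :
    Tendsto (fun δ : ℝ => (1 - Real.exp (-δ)) / δ) (𝓝[>] 0) (𝓝 1) := by
  have h : HasDerivAt (fun δ : ℝ => 1 - Real.exp (-δ)) 1 0 := by
    simpa using ((hasDerivAt_neg (0 : ℝ)).exp).const_sub 1
  have h1 := hasDerivAt_iff_tendsto_slope.1 h
  refine (h1.mono_left (nhdsWithin_mono _ fun x hx => ne_of_gt hx)).congr fun δ => ?_
  simp [slope_def_field]

/-- The constant in Mertens' second theorem for the primes `p ≡ 1 (mod 4)`. -/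
lemma exp_neg_eq_of_tendsto_sum_logFactor {M : ℝ}
    (hM : Tendsto (fun N : ℕ => ∑ n ∈ range (N + 1), logFactor 1 n -
      Real.log (Real.log (N + 1 : ℕ))) atTop (𝓝 M)) :
    Real.exp (-M) = Real.pi * Real.exp (-Real.eulerMascheroniConstant) := by
  have h1 := (tendsto_tsum_logFactor_one_mul_exp hM).sub tendsto_tsum_logFactor_one_mul_exp_sub
  rw [sub_zero] at h1
  have h2 := (Real.continuous_exp.tendsto _).comp h1
  have h3 := tendsto_mul_exp_tsum_logFactor.mul tendsto_one_sub_exp_neg_div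
  have h4 : Real.exp (M - Real.eulerMascheroniConstant) = 1 / Real.pi * 1 := by
    refine tendsto_nhds_unique h2 (h3.congr' ?_)
    filter_upwards [self_mem_nhdsWithin] with δ hδ
    replace hδ : 0 < δ := hδ
    have hs1 : Summable fun n : ℕ => logFactor 1 n * Real.exp (-δ * Real.log n) :=
      (summable_logFactor_one_mul_exp hδ).congr fun n => by
        rw [abs_of_nonneg (logFactor_nonneg le_rfl n)]
    have hpos : 0 < 1 - Real.exp (-δ) := by
      rw [sub_pos, Real.exp_lt_one_iff]
      linarith
    rw [Function.comp_apply, hs1.tsum_sub (summable_logFactor (by linarith)), add_sub_sub_cancel,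
      add_comm, Real.exp_add, Real.exp_log hpos]
    field_simp
  have hpi := Real.pi_pos
  rw [show -M = -(M - Real.eulerMascheroniConstant) + -Real.eulerMascheroniConstant by ring,
    Real.exp_add, Real.exp_neg, h4, mul_one, one_div, inv_inv]

lemma multipliable_one_sub_one_div_sq :
    Multipliable (fun p : {p : ℕ // p.Prime ∧ p % 4 = 1} => 1 - 1 / ((p : ℕ) : ℝ) ^ 2) := by
  have hs : Summable fun n : ℕ => -(1 / (n : ℝ) ^ 2) := hasSum_zeta_two.summable.neg
  exact Real.multipliable_one_add_of_summable (hs.subtype {p : ℕ | p.Prime ∧ p % 4 = 1})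

lemma tendsto_prod_one_sub_one_div_sq :
    Tendsto (fun N : ℕ => ∏ p ∈ N.primesBelow.filter (fun p => p % 4 = 1), (1 - 1 / (p : ℝ) ^ 2))
      atTop (𝓝 (∏' p : {p : ℕ // p.Prime ∧ p % 4 = 1}, (1 - 1 / ((p : ℕ) : ℝ) ^ 2))) := by
  have h := (hasProd_subtype_iff_mulIndicator (f := fun n : ℕ => 1 - 1 / (n : ℝ) ^ 2)
    (s := {p : ℕ | p.Prime ∧ p % 4 = 1})).1 multipliable_one_sub_one_div_sq.hasProd
  refine h.tendsto_prod_nat.congr fun N => ?_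
  rw [Nat.primesBelow, filter_filter, prod_filter]
  exact prod_congr rfl fun n _ => by rw [Set.mulIndicator_apply]; rfl

lemma prod_one_sub_one_div_sq_eq (N : ℕ) :
    (∏ p ∈ N.primesBelow.filter (fun p => p % 4 = 1), (1 - 1 / (p : ℝ))) ^ 2 =
      Real.exp (-∑ n ∈ range N, logFactor 1 n) *
        ∏ p ∈ N.primesBelow.filter (fun p => p % 4 = 1), (1 - 1 / (p : ℝ) ^ 2) := by
  have h1 : ∑ n ∈ range N, logFactor 1 n =
      ∑ p ∈ N.primesBelow.filter (fun p => p % 4 = 1), logFactor 1 p := by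
    rw [← sum_primesBelow_logFactor, sum_filter_of_ne]
    intro p _ hp
    by_contra h
    exact hp (if_neg fun h' => h h'.2)
  rw [h1, ← sum_neg_distrib, Real.exp_sum, ← prod_mul_distrib, ← prod_pow]
  refine prod_congr rfl fun p hp => ?_
  obtain ⟨hp, hp4⟩ := mem_filter.1 hp
  have hp' := Nat.prime_of_mem_primesBelow hp
  have h2 : (1 : ℝ) < p := by exact_mod_cast hp'.one_lt
  rw [Real.exp_neg, exp_logFactor ⟨hp', hp4⟩ le_rfl, Real.rpow_neg_one]
  have h3 : (p : ℝ) - 1 ≠ 0 := by linarith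
  have h4 : (p : ℝ) + 1 ≠ 0 := by positivity
  have h5 : (p : ℝ) ≠ 0 := by positivity
  rw [show 1 + (p : ℝ)⁻¹ = (p + 1) / p by field_simp,
    show 1 - (p : ℝ)⁻¹ = (p - 1) / p by field_simp]
  field_simp
  ring

/-- **Uchiyama's formula for `C(4,1)`:**
`log x · (∏_{p ≤ x, p ≡ 1 (4)} (1 - 1/p))² → π e^{-γ} ∏_{p ≡ 1 (4)} (1 - 1/p²)`,
the last product (over all primes `p ≡ 1 (mod 4)`) being absolutely convergent. -/
theorem uchiyama_C41 :
    Multipliable (fun p : {p : ℕ // p.Prime ∧ p % 4 = 1} =>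
      1 - 1 / ((p : ℕ) : ℝ) ^ 2) ∧
    Tendsto (fun x : ℝ => Real.log x *
        (∏ p ∈ (Nat.floor x + 1).primesBelow.filter (fun p => p % 4 = 1),
          (1 - 1 / (p : ℝ))) ^ 2)
      atTop (𝓝 (Real.pi * Real.exp (-Real.eulerMascheroniConstant) *
        ∏' p : {p : ℕ // p.Prime ∧ p % 4 = 1}, (1 - 1 / ((p : ℕ) : ℝ) ^ 2))) := by
  refine ⟨multipliable_one_sub_one_div_sq, ?_⟩
  obtain ⟨M, hM⟩ := exists_tendsto_sum_logFactor_sub_log_log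
  have hfloor := tendsto_nat_floor_atTop (α := ℝ)
  have h1 := (Real.continuous_exp.tendsto _).comp
    ((hM.comp hfloor).add tendsto_log_log_floor_add_one_sub).neg
  have h2 := tendsto_prod_one_sub_one_div_sq.comp ((tendsto_add_atTop_nat 1).comp hfloor)
  rw [add_zero, exp_neg_eq_of_tendsto_sum_logFactor hM] at h1
  refine (h1.mul h2).congr' ?_
  filter_upwards [eventually_gt_atTop 1] with x hx
  simp only [Function.comp_apply]
  rw [prod_one_sub_one_div_sq_eq, ← mul_assoc]
  congr 1
  nth_rewrite 2 [← Real.exp_log (Real.log_pos hx)]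
  rw [← Real.exp_add]
  congr 1
  push_cast
  ring
end
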